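/- Let q be an even prime power with q ≥ 2048, let K be a complete k-cap in PG(4, q) with k ≥ q³ − 2q² + 3q√q + 8q − 9√q − 6, let π be a plane of PG(4, q) meeting K in exactly q points, and suppose δ₁, …, δ₅ are five distinct hyperplanes of PG(4, q) containing π with |δᵢ ∩ K| ≥ q² − 2q + 3√q + 2 for i = 1, …, 5. Then a contradiction follows; i.e., no such configuration exists. -/

import Mathlib

open Module

/-- Points of the projective space `PG(n, q)` over the field `F` (with `q = |F|`). -/
abbrev PGPoint (F : Type*) [Field F] (n : ℕ) := Projectivization F (Fin (n + 1) → F)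

/-- The set of projective points lying in the projective subspace determined by
a linear subspace `W`. -/
def ptsIn {F : Type*} [Field F] {n : ℕ} (W : Submodule F (Fin (n + 1) → F)) :
    Set (PGPoint F n) := {P | P.submodule ≤ W}

/-- Three points of `PG(n, q)` are collinear if they lie on a common line. -/
def Coll3 {F : Type*} [Field F] {n : ℕ} (P₁ P₂ P₃ : PGPoint F n) : Prop :=
  Module.finrank F ↥(P₁.submodule ⊔ P₂.submodule ⊔ P₃.submodule) ≤ 2

/-- A cap (a plane arc when `n = 2`): a set of points no three of which are collinear. -/
def IsCap {F : Type*} [Field F] {n : ℕ} (K : Set (PGPoint F n)) : Prop :=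
  ∀ P₁ ∈ K, ∀ P₂ ∈ K, ∀ P₃ ∈ K, P₁ ≠ P₂ → P₁ ≠ P₃ → P₂ ≠ P₃ → ¬ Coll3 P₁ P₂ P₃

/-- A complete cap: a cap that is not contained in a cap with one more point. -/
def IsCompleteCap {F : Type*} [Field F] {n : ℕ} (K : Set (PGPoint F n)) : Prop :=
  IsCap K ∧ ∀ P ∉ K, ¬ IsCap (insert P K)

/-- A tangent line of `K`: a line (2-dimensional linear subspace) meeting `K`
in exactly one point. -/
def IsTangent {F : Type*} [Field F] {n : ℕ} (K : Set (PGPoint F n))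
    (W : Submodule F (Fin (n + 1) → F)) : Prop :=
  Module.finrank F W = 2 ∧ (ptsIn W ∩ K).ncard = 1


set_option linter.unusedSectionVars false

section affine
open Polynomial

variable {F : Type*} [Field F] [Fintype F] [DecidableEq F]

lemma prod_univ_erase_sub (x : F) : ∏ y ∈ Finset.univ.erase x, (x - y) = -1 := by
  have h1 : ∏ y ∈ Finset.univ.erase x, (x - y) = ∏ z ∈ Finset.univ.erase (0 : F), z := by
    refine Finset.prod_bij' (fun y _ => x - y) (fun z _ => x - z) ?_ ?_ ?_ ?_ ?_
    · intro a ha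
      simp only [Finset.mem_erase, Finset.mem_univ, and_true] at ha ⊢
      exact sub_ne_zero.mpr (Ne.symm ha)
    · intro a ha
      simp only [Finset.mem_erase, Finset.mem_univ, and_true] at ha ⊢
      intro h
      exact ha (by linear_combination -h)
    · intro a _; ring
    · intro a _; ring
    · intro a _; rfl
  rw [h1]
  have h2 : ∏ z ∈ Finset.univ.erase (0 : F), z = ∏ u : Fˣ, (u : F) := by
    symm
    refine Finset.prod_bij (fun (u : Fˣ) _ => (u : F)) ?_ ?_ ?_ ?_
    · intro u _; simp
    · intro a _ b _ h; exact Units.ext h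
    · intro b hb
      simp only [Finset.mem_erase, Finset.mem_univ, and_true] at hb
      exact ⟨Units.mk0 b hb, Finset.mem_univ _, rfl⟩
    · intro a _; rfl
  rw [h2]
  have := congrArg (Units.val) (FiniteField.prod_univ_units_id_eq_neg_one (K := F))
  simpa using this

/-- Wilson-type evaluation: nodal polynomial of the complement. -/
lemma eval_compl {ι : Type*} [DecidableEq ι] (s : Finset ι) (v : ι → F) (hv : Set.InjOn v s)
    {i : ι} (hi : i ∈ s) :
    (∏ c ∈ (s.image v)ᶜ, (v i - c)) * ∏ j ∈ s.erase i, (v i - v j) = -1 := by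
  rw [← prod_univ_erase_sub (v i)]
  have h : ∏ j ∈ s.erase i, (v i - v j) = ∏ c ∈ (s.image v).erase (v i), (v i - c) := by
    have : (s.image v).erase (v i) = (s.erase i).image v := by
      ext c
      simp only [Finset.mem_erase, Finset.mem_image]
      constructor
      · rintro ⟨h1, j, hj, rfl⟩
        exact ⟨j, ⟨fun h => h1 (by rw [h]), hj⟩, rfl⟩
      · rintro ⟨j, ⟨h1, hj⟩, rfl⟩
        exact ⟨fun h => h1 (hv hj hi h), j, hj, rfl⟩
    rw [this, Finset.prod_image]
    intro a ha b hb hab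
    exact hv (Finset.mem_of_mem_erase ha) (Finset.mem_of_mem_erase hb) hab
  rw [h, ← Finset.prod_union]
  · apply Finset.prod_congr _ (fun _ _ => rfl)
    ext c
    simp only [Finset.mem_union, Finset.mem_compl, Finset.mem_erase, Finset.mem_univ, and_true]
    constructor
    · rintro (h | h)
      · rintro rfl
        exact h (Finset.mem_image_of_mem v hi)
      · exact h.1
    · intro h
      by_cases hc : c ∈ s.image v
      · exact Or.inr ⟨h, hc⟩
      · exact Or.inl hc
  · rw [Finset.disjoint_left]
    intro c hc hc'
    exact (Finset.mem_compl.mp hc) (Finset.mem_of_mem_erase hc')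

/-- slope of the line joining two affine points -/
def slp (P Q : F × F) : F := (Q.2 + P.2) / (Q.1 + P.1)

def KK (A : Finset (F × F)) (P Q : F × F) : F :=
  (∏ S ∈ A.erase Q, (slp P Q - slp P S)) * ∏ S ∈ A.erase P, (S.1 + P.1)

variable [CharP F 2]

lemma ne_add {a b : F} (h : a ≠ b) : a + b ≠ 0 := by
  rwa [← CharTwo.sub_eq_add, sub_ne_zero]

lemma slp_self (P : F × F) : slp P P = 0 := by
  unfold slp; rw [CharTwo.add_self_eq_zero, CharTwo.add_self_eq_zero]; simp

lemma slp_symm (P Q : F × F) : slp P Q = slp Q P := by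
  unfold slp; rw [add_comm Q.2, add_comm Q.1]

lemma KK_symm (A : Finset (F × F)) (hA1 : ∀ P ∈ A, ∀ Q ∈ A, P ≠ Q → P.1 ≠ Q.1)
    {P Q : F × F} (hP : P ∈ A) (hQ : Q ∈ A) (hPQ : P ≠ Q) : KK A P Q = KK A Q P := by
  have key : ∀ P ∈ A, ∀ Q ∈ A, P ≠ Q → KK A P Q = slp P Q * (Q.1 + P.1) *
      ∏ S ∈ (A.erase Q).erase P,
        (((Q.1 + P.1) * (S.2 + P.2) + (Q.2 + P.2) * (S.1 + P.1)) / (Q.1 + P.1)) := by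
    intro P hP Q hQ hPQ
    unfold KK
    rw [← Finset.mul_prod_erase (A.erase Q) _ (Finset.mem_erase.mpr ⟨hPQ, hP⟩),
      ← Finset.mul_prod_erase (A.erase P) _ (Finset.mem_erase.mpr ⟨hPQ.symm, hQ⟩),
      Finset.erase_right_comm (a := P) (b := Q), slp_self, sub_zero]
    rw [mul_mul_mul_comm, ← Finset.prod_mul_distrib]
    congr 1
    apply Finset.prod_congr rfl
    intro S hS
    simp only [Finset.mem_erase] at hS
    have h1 : Q.1 + P.1 ≠ 0 := ne_add (hA1 Q hQ P hP hPQ.symm)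
    have h2 : S.1 + P.1 ≠ 0 := ne_add (hA1 S hS.2.2 P hP hS.1)
    unfold slp
    rw [CharTwo.sub_eq_add]
    field_simp
    ring
  rw [key P hP Q hQ hPQ, key Q hQ P hP hPQ.symm, slp_symm, Finset.erase_right_comm,
    add_comm P.1 Q.1]
  congr 1
  apply Finset.prod_congr rfl
  intro S _
  congr 1
  have h2 : (2 : F) = 0 := CharTwo.two_eq_zero
  linear_combination (P.1 * P.2 - Q.1 * Q.2) * h2

lemma natDegree_nodal (s : Finset F) : (∏ c ∈ s, (X - C c) : F[X]).natDegree = s.card := by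
  exact natDegree_finsetProd_X_sub_C_eq_card s (fun c => c)

lemma monic_coeff_nodal (s : Finset F) : (∏ c ∈ s, (X - C c) : F[X]).coeff s.card = 1 := by
  have h := monic_prod_X_sub_C (fun c : F => c) s
  have h3 := h.coeff_natDegree
  rw [natDegree_nodal] at h3
  exact h3

lemma degree_nodal (s : Finset F) :
    (∏ c ∈ s, (X - C c) : F[X]).degree = (s.card : WithBot ℕ) := by
  have h := monic_prod_X_sub_C (fun c : F => c) s
  rw [degree_eq_natDegree h.ne_zero, natDegree_nodal]

/-- Affine form of Segre's theorem on tangents of arcs in even characteristic. -/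
lemma segre_affine (A U : Finset (F × F)) (hUA : U ⊆ A)
    (hA1 : ∀ P ∈ A, ∀ Q ∈ A, P ≠ Q → P.1 ≠ Q.1)
    (hA2 : ∀ P ∈ A, ∀ Q ∈ A, P ≠ Q → P.2 ≠ Q.2)
    (hA3 : ∀ P ∈ A, ∀ Q ∈ A, ∀ S ∈ A, P ≠ Q → P ≠ S → Q ≠ S →
      (Q.1 + P.1) * (S.2 + P.2) + (Q.2 + P.2) * (S.1 + P.1) ≠ 0)
    (hU : ∀ P ∈ U, ∀ S ∈ A, S ≠ P → S.1 + S.2 ≠ P.1 + P.2) :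
    U.card + A.card ≤ Fintype.card F := by
  by_contra hcon
  push Not at hcon
  have hinj1 : Set.InjOn (Prod.snd : F × F → F) A := by
    intro P hP Q hQ h
    by_contra hne
    exact hA2 P hP Q hQ hne h
  have hAq : A.card ≤ Fintype.card F := by
    rw [← Finset.card_image_of_injOn hinj1]
    exact Finset.card_le_univ _
  obtain ⟨d, hd⟩ := Nat.exists_eq_add_of_le hAq
  obtain ⟨E, hEU, hEc⟩ := Finset.exists_subset_card_eq (s := U) (n := d + 1) (by omega)
  have hEA : E ⊆ A := hEU.trans hUA
  -- slopes are injective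
  have hslp : ∀ P ∈ A, Set.InjOn (slp P) A := by
    intro P hP Q hQ S hS h
    by_contra hne
    have aux : ∀ Q ∈ A, P ≠ Q → slp P Q ≠ 0 := by
      intro Q hQ h
      exact div_ne_zero (ne_add (hA2 Q hQ P hP h.symm)) (ne_add (hA1 Q hQ P hP h.symm))
    by_cases h1 : P = Q
    · subst h1
      rw [slp_self] at h
      exact aux S hS hne h.symm
    by_cases h2 : P = S
    · subst h2
      rw [slp_self] at h
      exact aux Q hQ h1 h
    apply hA3 P hP Q hQ S hS h1 h2 hne
    unfold slp at h
    rw [div_eq_div_iff (ne_add (hA1 Q hQ P hP (Ne.symm h1)))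
      (ne_add (hA1 S hS P hP (Ne.symm h2)))] at h
    rw [← CharTwo.sub_eq_add]
    linear_combination -h
  -- the relation at R
  have hR : ∑ P ∈ E, ((∏ S ∈ A.erase P, (P.2 - S.2)) * ∏ S ∈ E.erase P, (P.2 - S.2))⁻¹ = -1 := by
    have hc : ((A.image Prod.snd)ᶜ : Finset F).card = d := by
      rw [Finset.card_compl, Finset.card_image_of_injOn hinj1]; omega
    have h := Lagrange.coeff_eq_sum (s := E) (v := (Prod.snd : F × F → F))
      (P := ∏ c ∈ (A.image Prod.snd)ᶜ, (X - C c))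
      (hinj1.mono (by exact_mod_cast hEA)) (by rw [degree_nodal, hc, hEc]; exact_mod_cast Nat.lt_succ_self d)
    have h1 : E.card - 1 = ((A.image Prod.snd)ᶜ : Finset F).card := by omega
    rw [h1, monic_coeff_nodal] at h
    rw [h, ← Finset.sum_neg_distrib]
    apply Finset.sum_congr rfl
    intro P hP
    have h2 := eval_compl A Prod.snd hinj1 (hEA hP)
    have h3 : ∏ S ∈ A.erase P, (P.2 - S.2) ≠ 0 := by
      intro h0; rw [h0] at h2; simp at h2
    rw [eval_prod]
    simp only [eval_sub, eval_X, eval_C]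
    rw [mul_inv, eq_comm, div_eq_mul_inv, neg_eq_iff_eq_neg, ← neg_mul]
    congr 1
    field_simp
    linear_combination h2
  -- the relation at P
  have hP0 : ∀ P ∈ E, ∑ Q ∈ E, ((slp P Q - 1) * (KK A P Q) * (KK E P Q))⁻¹ = 0 := by
    intro P hP
    have hPA := hEA hP
    have hinj := hslp P hPA
    have hc : ((A.image (slp P))ᶜ : Finset F).card = d := by
      rw [Finset.card_compl, Finset.card_image_of_injOn hinj]; omega
    have hone : ∀ S ∈ A, slp P S ≠ 1 := by
      intro S hS h
      by_cases hSP : S = P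
      · subst hSP
        rw [slp_self] at h
        exact zero_ne_one h
      · unfold slp at h
        rw [div_eq_one_iff_eq (ne_add (hA1 S hS P hPA hSP))] at h
        apply hU P (hEU hP) S hS hSP
        have h2 : (2 : F) = 0 := CharTwo.two_eq_zero
        linear_combination h + (S.1 - P.2) * h2
    have h1m : (1 : F) ∈ (A.image (slp P))ᶜ := by
      rw [Finset.mem_compl, Finset.mem_image]
      rintro ⟨S, hS, h⟩
      exact hone S hS h
    have hce : (((A.image (slp P))ᶜ : Finset F).erase 1).card = d - 1 := by
      rw [Finset.card_erase_of_mem h1m, hc]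
    have hdpos : 0 < d := by
      rw [← hc]; exact Finset.card_pos.mpr ⟨1, h1m⟩
    have h := Lagrange.coeff_eq_sum (s := E) (v := slp P)
      (P := ∏ c ∈ ((A.image (slp P))ᶜ : Finset F).erase 1, (X - C c))
      (hinj.mono (by exact_mod_cast hEA))
      (by rw [degree_nodal, hce, hEc]; exact_mod_cast (by omega : d - 1 < d + 1))
    rw [coeff_eq_zero_of_degree_lt
      (by rw [degree_nodal, hce, hEc]; exact_mod_cast (by omega : d - 1 < d + 1 - 1))] at h
    have hα : ∀ B : Finset (F × F), B ⊆ A → ∏ S ∈ B.erase P, (S.1 + P.1) ≠ 0 := by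
      intro B hB
      rw [Finset.prod_ne_zero_iff]
      intro S hS
      rw [Finset.mem_erase] at hS
      exact ne_add (hA1 S (hB hS.2) P hPA hS.1)
    have h' : ∑ Q ∈ E, ((slp P Q - 1) * (KK A P Q) * (KK E P Q))⁻¹
        = (- ((∏ S ∈ A.erase P, (S.1 + P.1)) * ∏ S ∈ E.erase P, (S.1 + P.1))⁻¹) * 0 := by
      rw [h, Finset.mul_sum]
      apply Finset.sum_congr rfl
      intro Q hQ
      have hQA := hEA hQ
      have h2 := eval_compl A (slp P) hinj hQA
      rw [← Finset.mul_prod_erase _ _ h1m] at h2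
      have hne1 : slp P Q - 1 ≠ 0 := sub_ne_zero.mpr (hone Q hQA)
      have h3 : ∏ S ∈ A.erase Q, (slp P Q - slp P S) ≠ 0 := by
        intro h0; rw [h0] at h2; simp at h2
      have h4 : ∏ S ∈ E.erase Q, (slp P Q - slp P S) ≠ 0 := by
        rw [Finset.prod_ne_zero_iff]
        intro S hS
        rw [Finset.mem_erase] at hS
        exact sub_ne_zero.mpr (fun h => hS.1 (hinj (hEA hS.2) hQA h.symm))
      rw [eval_prod]
      simp only [eval_sub, eval_X, eval_C]
      unfold KK
      have h5 := hα A subset_rfl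
      have h6 := hα E hEA
      generalize (∏ c ∈ ((A.image (slp P))ᶜ : Finset F).erase 1, (slp P Q - c)) = x1 at *
      generalize (∏ S ∈ A.erase Q, (slp P Q - slp P S)) = x2 at *
      generalize (∏ S ∈ E.erase Q, (slp P Q - slp P S)) = x3 at *
      generalize (∏ S ∈ A.erase P, (S.1 + P.1)) = x4 at *
      generalize (∏ S ∈ E.erase P, (S.1 + P.1)) = x5 at *
      field_simp
      linear_combination h2
    rw [h', mul_zero]
  have hdiag : ∀ P ∈ E, ((slp P P - 1) * (KK A P P) * (KK E P P))⁻¹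
      = - ((∏ S ∈ A.erase P, (P.2 - S.2)) * ∏ S ∈ E.erase P, (P.2 - S.2))⁻¹ := by
    intro P hP
    have hK : ∀ B : Finset (F × F), B ⊆ A → KK B P P = ∏ S ∈ B.erase P, (P.2 - S.2) := by
      intro B hB
      unfold KK
      rw [← Finset.prod_mul_distrib]
      apply Finset.prod_congr rfl
      intro S hS
      rw [Finset.mem_erase] at hS
      have h1 : S.1 + P.1 ≠ 0 := ne_add (hA1 S (hB hS.2) P (hEA hP) hS.1)
      rw [slp_self]
      unfold slp
      rw [CharTwo.sub_eq_add, CharTwo.sub_eq_add, zero_add]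
      field_simp
      ring
    rw [hK A subset_rfl, hK E hEA, slp_self, zero_sub, mul_assoc, neg_one_mul, inv_neg]
  have hsum : ∑ P ∈ E, ∑ Q ∈ E, ((slp P Q - 1) * (KK A P Q) * (KK E P Q))⁻¹ = 0 :=
    Finset.sum_eq_zero hP0
  have hsplit : ∑ P ∈ E, ∑ Q ∈ E, ((slp P Q - 1) * (KK A P Q) * (KK E P Q))⁻¹
      = ∑ P ∈ E, ((slp P P - 1) * (KK A P P) * (KK E P P))⁻¹ +
        ∑ p ∈ E.offDiag, ((slp p.1 p.2 - 1) * (KK A p.1 p.2) * (KK E p.1 p.2))⁻¹ := by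
    rw [← Finset.sum_product' E E (fun P Q => ((slp P Q - 1) * (KK A P Q) * (KK E P Q))⁻¹),
      ← Finset.diag_union_offDiag, Finset.sum_union (Finset.disjoint_diag_offDiag E),
      Finset.sum_diag]
  have hoff : ∑ p ∈ E.offDiag, ((slp p.1 p.2 - 1) * (KK A p.1 p.2) * (KK E p.1 p.2))⁻¹ = 0 := by
    refine Finset.sum_involution (fun p _ => (p.2, p.1)) ?_ ?_ ?_ ?_
    · rintro ⟨P, Q⟩ hp
      rw [Finset.mem_offDiag] at hp
      obtain ⟨h1, h2, h3⟩ := hp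
      simp only at h1 h2 h3 ⊢
      rw [slp_symm Q P, KK_symm A hA1 (hEA h2) (hEA h1) h3.symm,
        KK_symm E (fun P hP Q hQ => hA1 P (hEA hP) Q (hEA hQ)) h2 h1 h3.symm]
      exact CharTwo.add_self_eq_zero _
    · rintro ⟨P, Q⟩ hp _ h
      rw [Finset.mem_offDiag] at hp
      apply hp.2.2
      exact (congrArg Prod.snd h)
    · rintro ⟨P, Q⟩ hp
      rw [Finset.mem_offDiag] at hp ⊢
      exact ⟨hp.2.1, hp.1, hp.2.2.symm⟩
    · rintro ⟨P, Q⟩ hp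
      rfl
  rw [hsplit, hoff, add_zero, Finset.sum_congr rfl hdiag, Finset.sum_neg_distrib, hR] at hsum
  simp at hsum

end affine


set_option linter.unusedSectionVars false

section plane
open Module

variable {F : Type*} [Field F] {V : Type*} [AddCommGroup V] [Module F V] [FiniteDimensional F V]

lemma pt_span {P : Submodule F V} (h : finrank F P = 1) :
    ∃ v : V, v ≠ 0 ∧ P = Submodule.span F {v} := by
  have hb : P ≠ ⊥ := by
    rintro rfl
    simp at h
  obtain ⟨v, hv, h0⟩ := Submodule.exists_mem_ne_zero_of_ne_bot hb
  refine ⟨v, h0, ?_⟩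
  symm
  apply Submodule.eq_of_le_of_finrank_le
  · rwa [Submodule.span_singleton_le_iff_mem]
  · rw [h, finrank_span_singleton h0]

lemma pt_le_eq {P Q : Submodule F V} (hP : finrank F P = 1) (hQ : finrank F Q = 1)
    (h : P ≤ Q) : P = Q :=
  Submodule.eq_of_le_of_finrank_le h (by omega)

lemma pt_eq_of_mem {P : Submodule F V} (hP : finrank F P = 1) {v : V} (h0 : v ≠ 0)
    (hv : v ∈ P) : P = Submodule.span F {v} := by
  symm
  exact pt_le_eq (finrank_span_singleton h0) hP (by rwa [Submodule.span_singleton_le_iff_mem])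

lemma finrank_sup_pt {W P : Submodule F V} (hP : finrank F P = 1) (h : ¬ P ≤ W) :
    finrank F ↥(W ⊔ P) = finrank F W + 1 := by
  have h1 := Submodule.finrank_sup_add_finrank_inf_eq W P
  have h2 : finrank F ↥(W ⊓ P) = 0 := by
    by_contra hne
    have h3 : finrank F ↥(W ⊓ P) ≤ finrank F P := Submodule.finrank_mono inf_le_right
    have h4 : W ⊓ P = P := Submodule.eq_of_le_of_finrank_le inf_le_right (by omega)
    exact h (inf_eq_right.mp h4)
  omega

lemma exchange {W P Q : Submodule F V} (hP : finrank F P = 1) (hQ : finrank F Q = 1)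
    (h : ¬ P ≤ W) (h' : P ≤ W ⊔ Q) : W ⊔ P = W ⊔ Q := by
  apply Submodule.eq_of_le_of_finrank_le (sup_le le_sup_left h')
  have : ¬ Q ≤ W := fun hc => h (by rwa [sup_eq_left.mpr hc] at h')
  rw [finrank_sup_pt hP h, finrank_sup_pt hQ this]

lemma finrank_line {P Q : Submodule F V} (hP : finrank F P = 1) (hQ : finrank F Q = 1)
    (h : P ≠ Q) : finrank F ↥(P ⊔ Q) = 2 := by
  rw [finrank_sup_pt hQ (fun hc => h (pt_le_eq hQ hP hc).symm), hP]

lemma span_le_sup {x y z : V} {c d : F} (h : z = c • x + d • y) :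
    Submodule.span F {z} ≤ Submodule.span F {x} ⊔ Submodule.span F {y} := by
  rw [Submodule.span_singleton_le_iff_mem, h]
  exact Submodule.add_mem _
    (Submodule.mem_sup_left (Submodule.smul_mem _ _ (Submodule.mem_span_singleton_self x)))
    (Submodule.mem_sup_right (Submodule.smul_mem _ _ (Submodule.mem_span_singleton_self y)))

lemma mem_sup_span {x y z : V} (h : z ∈ Submodule.span F {x} ⊔ Submodule.span F {y}) :
    ∃ c d : F, z = c • x + d • y := by
  rw [Submodule.mem_sup] at h
  obtain ⟨a, ha, b, hb, rfl⟩ := h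
  rw [Submodule.mem_span_singleton] at ha hb
  obtain ⟨c, rfl⟩ := ha
  obtain ⟨d, rfl⟩ := hb
  exact ⟨c, d, rfl⟩

set_option maxHeartbeats 2000000 in
lemma segre_plane [Fintype F] [CharP F 2] {α : Submodule F V} (hα : finrank F α = 3)
    (A U : Finset (Submodule F V)) (hA : ∀ P ∈ A, finrank F P = 1) (hAα : ∀ P ∈ A, P ≤ α)
    (hcap : ∀ P ∈ A, ∀ Q ∈ A, ∀ S ∈ A, P ≠ Q → P ≠ S → Q ≠ S → ¬ S ≤ P ⊔ Q)
    {R R' Z : Submodule F V} (hR : R ∈ A) (hR' : R' ∈ A) (hRR : R ≠ R')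
    (hZ : finrank F Z = 1) (hZR : Z ≤ R ⊔ R') (hZA : Z ∉ A) (hUA : U ⊆ A)
    (hU : ∀ P ∈ U, ∀ S ∈ A, S ≠ P → ¬ S ≤ Z ⊔ P) :
    U.card + A.card ≤ Fintype.card F + 2 := by
  classical
  obtain ⟨r0, hr0, hRr0⟩ := pt_span (hA R hR)
  obtain ⟨s0, hs0, hRs0⟩ := pt_span (hA R' hR')
  obtain ⟨x, hx, hZx⟩ := pt_span hZ
  have hxm : x ∈ Submodule.span F {r0} ⊔ Submodule.span F {s0} := by
    rw [← hRr0, ← hRs0]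
    apply hZR
    rw [hZx]; exact Submodule.mem_span_singleton_self x
  obtain ⟨a, b, hab⟩ := mem_sup_span hxm
  have ha : a ≠ 0 := by
    rintro rfl
    apply hZA
    have : Z = R' := by
      apply pt_le_eq hZ (hA R' hR')
      rw [hZx, hRs0, Submodule.span_singleton_le_iff_mem, hab, zero_smul, zero_add]
      exact Submodule.smul_mem _ _ (Submodule.mem_span_singleton_self _)
    rwa [this]
  have hb : b ≠ 0 := by
    rintro rfl
    apply hZA
    have : Z = R := by
      apply pt_le_eq hZ (hA R hR)
      rw [hZx, hRr0, Submodule.span_singleton_le_iff_mem, hab, zero_smul, add_zero]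
      exact Submodule.smul_mem _ _ (Submodule.mem_span_singleton_self _)
    rwa [this]
  obtain ⟨r, hr⟩ : ∃ r, r = a • r0 := ⟨_, rfl⟩
  obtain ⟨s, hs⟩ : ∃ s, s = b • s0 := ⟨_, rfl⟩
  have hr1 : r ≠ 0 := by rw [hr]; exact smul_ne_zero ha hr0
  have hs1 : s ≠ 0 := by rw [hs]; exact smul_ne_zero hb hs0
  have hRr : R = Submodule.span F {r} := by
    apply pt_eq_of_mem (hA R hR) hr1
    rw [hRr0, hr]; exact Submodule.smul_mem _ _ (Submodule.mem_span_singleton_self _)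
  have hRs : R' = Submodule.span F {s} := by
    apply pt_eq_of_mem (hA R' hR') hs1
    rw [hRs0, hs]; exact Submodule.smul_mem _ _ (Submodule.mem_span_singleton_self _)
  rw [← hr, ← hs] at hab
  have hlin := finrank_line (hA R hR) (hA R' hR') hRR
  have hle : R ⊔ R' ≤ α := sup_le (hAα R hR) (hAα R' hR')
  obtain ⟨o, hoα, hoL⟩ : ∃ o ∈ α, o ∉ R ⊔ R' := by
    by_contra hcon
    push Not at hcon
    have h1 : finrank F α ≤ finrank F ↥(R ⊔ R') := Submodule.finrank_mono hcon
    omega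
  have ho0 : o ≠ 0 := by rintro rfl; exact hoL (Submodule.zero_mem _)
  have hαe : (R ⊔ R') ⊔ Submodule.span F {o} = α := by
    apply Submodule.eq_of_le_of_finrank_le
    · exact sup_le hle (by rwa [Submodule.span_singleton_le_iff_mem])
    · rw [finrank_sup_pt (finrank_span_singleton ho0)
        (by rwa [Submodule.span_singleton_le_iff_mem])]
      omega
  have hcoord : ∀ P ∈ A, P ≠ R → P ≠ R' →
      ∃ f : F × F, P = Submodule.span F {o + f.1 • r + f.2 • s} := by
    intro P hP h1 h2
    obtain ⟨p, hp0, hPp⟩ := pt_span (hA P hP)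
    have hpα : p ∈ (R ⊔ R') ⊔ Submodule.span F {o} := by
      rw [hαe]; apply hAα P hP; rw [hPp]; exact Submodule.mem_span_singleton_self _
    rw [Submodule.mem_sup] at hpα
    obtain ⟨y, hy, z, hz, hyz⟩ := hpα
    rw [Submodule.mem_span_singleton] at hz
    obtain ⟨e, rfl⟩ := hz
    rw [hRr, hRs] at hy
    obtain ⟨c, d, rfl⟩ := mem_sup_span hy
    have he : e ≠ 0 := by
      rintro rfl
      apply hcap R hR R' hR' P hP hRR (Ne.symm h1) (Ne.symm h2)
      rw [hPp, hRr, hRs]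
      exact span_le_sup (c := c) (d := d) (by rw [← hyz]; simp)
    refine ⟨(e⁻¹ * c, e⁻¹ * d), ?_⟩
    have : o + (e⁻¹ * c) • r + (e⁻¹ * d) • s = e⁻¹ • p := by
      rw [← hyz, smul_add, smul_add, smul_smul, smul_smul, smul_smul, inv_mul_cancel₀ he, one_smul]
      abel
    rw [this]
    apply pt_eq_of_mem (hA P hP) (smul_ne_zero (inv_ne_zero he) hp0)
    rw [hPp]; exact Submodule.smul_mem _ _ (Submodule.mem_span_singleton_self _)
  have hcoord' : ∀ P : Submodule F V, ∃ f : F × F, P ∈ A → P ≠ R → P ≠ R' →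
      P = Submodule.span F {o + f.1 • r + f.2 • s} := by
    intro P
    by_cases h : P ∈ A ∧ P ≠ R ∧ P ≠ R'
    · obtain ⟨f, hf⟩ := hcoord P h.1 h.2.1 h.2.2
      exact ⟨f, fun _ _ _ => hf⟩
    · exact ⟨0, fun h1 h2 h3 => absurd ⟨h1, h2, h3⟩ h⟩
  choose f hf using hcoord'
  have hmem : ∀ P, P ∈ (A.erase R).erase R' ↔ P ∈ A ∧ P ≠ R ∧ P ≠ R' := by
    intro P; simp only [Finset.mem_erase]; tauto
  have hfm : ∀ P ∈ (A.erase R).erase R', P = Submodule.span F {o + (f P).1 • r + (f P).2 • s} := by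
    intro P hP
    rw [hmem] at hP
    exact hf P hP.1 hP.2.1 hP.2.2
  have hinj : Set.InjOn f ((A.erase R).erase R' : Finset (Submodule F V)) := by
    intro P hP Q hQ h
    rw [hfm P hP, hfm Q hQ, h]
  have hUA' : U ⊆ (A.erase R).erase R' := by
    intro P hP
    rw [hmem]
    refine ⟨hUA hP, ?_, ?_⟩
    · rintro rfl
      apply hU P hP R' hR' (Ne.symm hRR)
      rw [hZx, hRs, hRr]
      exact span_le_sup (c := 1) (d := -1) (by rw [hab]; simp)
    · rintro rfl
      apply hU P hP R hR hRR
      rw [hZx, hRs, hRr]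
      exact span_le_sup (c := 1) (d := -1) (by rw [hab]; simp)
  have h2 : (2 : F) = 0 := CharTwo.two_eq_zero
  have hA1 : ∀ P ∈ (A.erase R).erase R', ∀ Q ∈ (A.erase R).erase R', P ≠ Q → (f P).1 ≠ (f Q).1 := by
    intro P hP Q hQ hne h
    have hd : (f P).2 - (f Q).2 ≠ 0 := by
      intro h0
      exact hne (hinj hP hQ (Prod.ext h (sub_eq_zero.mp h0)))
    have hP' := (hmem P).mp hP
    have hQ' := (hmem Q).mp hQ
    apply hcap P hP'.1 Q hQ'.1 R' hR' hne hP'.2.2 hQ'.2.2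
    rw [hRs, hfm P hP, hfm Q hQ]
    apply span_le_sup (c := ((f P).2 - (f Q).2)⁻¹) (d := -((f P).2 - (f Q).2)⁻¹)
    rw [h]
    match_scalars <;> field_simp <;> ring
  have hA2 : ∀ P ∈ (A.erase R).erase R', ∀ Q ∈ (A.erase R).erase R', P ≠ Q → (f P).2 ≠ (f Q).2 := by
    intro P hP Q hQ hne h
    have hd : (f P).1 - (f Q).1 ≠ 0 := by
      intro h0
      exact hne (hinj hP hQ (Prod.ext (sub_eq_zero.mp h0) h))
    have hP' := (hmem P).mp hP
    have hQ' := (hmem Q).mp hQ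
    apply hcap P hP'.1 Q hQ'.1 R hR hne hP'.2.1 hQ'.2.1
    rw [hRr, hfm P hP, hfm Q hQ]
    apply span_le_sup (c := ((f P).1 - (f Q).1)⁻¹) (d := -((f P).1 - (f Q).1)⁻¹)
    rw [h]
    match_scalars <;> field_simp <;> ring
  have key := segre_affine (((A.erase R).erase R').image f) (U.image f)
    (Finset.image_subset_image hUA') ?_ ?_ ?_ ?_
  · rw [Finset.card_image_of_injOn hinj, Finset.card_image_of_injOn
      (hinj.mono (by exact_mod_cast hUA')),
      Finset.card_erase_of_mem (Finset.mem_erase.mpr ⟨Ne.symm hRR, hR'⟩),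
      Finset.card_erase_of_mem hR] at key
    omega
  · simp only [Finset.mem_image]
    rintro _ ⟨P, hP, rfl⟩ _ ⟨Q, hQ, rfl⟩ hne
    exact hA1 P hP Q hQ (fun h => hne (by rw [h]))
  · simp only [Finset.mem_image]
    rintro _ ⟨P, hP, rfl⟩ _ ⟨Q, hQ, rfl⟩ hne
    exact hA2 P hP Q hQ (fun h => hne (by rw [h]))
  · simp only [Finset.mem_image]
    rintro _ ⟨P, hP, rfl⟩ _ ⟨Q, hQ, rfl⟩ _ ⟨S, hS, rfl⟩ h1 h2' h3 h
    have hPQ : P ≠ Q := fun h => h1 (by rw [h])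
    apply hcap P ((hmem P).mp hP).1 Q ((hmem Q).mp hQ).1 S ((hmem S).mp hS).1 hPQ
      (fun h => h2' (by rw [h])) (fun h => h3 (by rw [h]))
    have hd : (f Q).1 - (f P).1 ≠ 0 := sub_ne_zero.mpr (hA1 Q hQ P hP (Ne.symm hPQ))
    have h4 : ((f Q).1 - (f P).1) * ((f S).2 - (f P).2) =
        ((f Q).2 - (f P).2) * ((f S).1 - (f P).1) := by
      linear_combination h - ((f Q).1 * (f P).2 + (f P).1 * (f S).2 +
        (f Q).2 * ((f S).1) + (f P).1 * (f P).2) * h2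
    have h5 : (f S).2 = (f P).2 + ((f Q).2 - (f P).2) * ((f S).1 - (f P).1) / ((f Q).1 - (f P).1) := by
      rw [← h4]; field_simp; ring
    rw [hfm P hP, hfm Q hQ, hfm S hS]
    apply span_le_sup (c := 1 - ((f S).1 - (f P).1) / ((f Q).1 - (f P).1))
      (d := ((f S).1 - (f P).1) / ((f Q).1 - (f P).1))
    rw [h5]
    match_scalars
    · ring
    · field_simp; ring
    · field_simp; ring
  · simp only [Finset.mem_image]
    rintro _ ⟨P, hP, rfl⟩ _ ⟨S, hS, rfl⟩ hne h
    have hP' := hUA' hP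
    apply hU P hP S ((hmem S).mp hS).1 (fun h => hne (by rw [h]))
    rw [hZx, hfm P hP', hfm S hS, hab]
    have h5 : (f S).2 = (f P).1 + (f P).2 - (f S).1 := by linear_combination h
    apply span_le_sup (c := (f S).1 - (f P).1) (d := 1)
    rw [h5]
    match_scalars
    · ring
    · ring
    · linear_combination ((f P).1 - (f S).1) * h2

end plane


set_option linter.unusedSectionVars false

section residue
open Classical in
/-- number of points of `B` on `l` -/
noncomputable def dd {π Λ : Type*} (I : π → Λ → Prop) (B : Finset π) (l : Λ) : ℕ :=
  (B.filter (fun x => I x l)).card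

open Classical in
structure Res {π Λ : Type*} (q : ℕ) (I : π → Λ → Prop) (B : Finset π) (L : Finset Λ) : Prop where
  hu : ∀ x ∈ B, ∀ y ∈ B, x ≠ y → ∀ l ∈ L, ∀ m ∈ L, I x l → I y l → I x m → I y m → l = m
  hex : ∀ x ∈ B, ∀ y ∈ B, x ≠ y → ∃ l ∈ L, I x l ∧ I y l
  hdeg : ∀ x ∈ B, (L.filter (fun l => I x l)).card = q + 1
  hL : L.card = q ^ 2 + q + 1
  hmax : ∀ l ∈ L, dd I B l ≤ q + 1
  hfull : ∀ l ∈ L, ∀ m ∈ L, l ≠ m → dd I B l = q + 1 → ∃ x ∈ B, I x l ∧ I x m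

variable {π Λ : Type*} {q : ℕ} {I : π → Λ → Prop} {B : Finset π} {L : Finset Λ}

open Classical in
lemma Res.inter_le (h : Res q I B L) {l m : Λ} (hl : l ∈ L) (hm : m ∈ L) (hlm : l ≠ m) :
    (B.filter (fun x => I x l ∧ I x m)).card ≤ 1 := by
  rw [Finset.card_le_one]
  intro x hx y hy
  rw [Finset.mem_filter] at hx hy
  by_contra hne
  exact hlm (h.hu x hx.1 y hy.1 hne l hl m hm hx.2.1 hy.2.1 hx.2.2 hy.2.2)

open Classical in
lemma Res.sum_through (h : Res q I B L) {x : π} (hx : x ∈ B) :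
    ∑ l ∈ L.filter (fun l => I x l), dd I B l = q + B.card := by
  have h1 : ∑ l ∈ L.filter (fun l => I x l), dd I B l =
      ∑ y ∈ B, ((L.filter (fun l => I x l)).filter (fun l => I y l)).card := by
    unfold dd
    exact Finset.sum_card_bipartiteAbove_eq_sum_card_bipartiteBelow (fun l y => I y l)
  rw [h1, ← Finset.add_sum_erase _ _ hx]
  have h2 : ((L.filter (fun l => I x l)).filter (fun l => I x l)).card = q + 1 := by
    rw [Finset.filter_filter]; simp only [and_self]; exact h.hdeg x hx
  have h3 : ∑ y ∈ B.erase x, ((L.filter (fun l => I x l)).filter (fun l => I y l)).card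
      = ∑ y ∈ B.erase x, 1 := by
    apply Finset.sum_congr rfl
    intro y hy
    rw [Finset.mem_erase] at hy
    obtain ⟨l, hl, h4, h5⟩ := h.hex x hx y hy.2 (Ne.symm hy.1)
    rw [Finset.card_eq_one]
    refine ⟨l, ?_⟩
    ext m
    simp only [Finset.mem_filter, Finset.mem_singleton]
    constructor
    · rintro ⟨⟨h6, h7⟩, h8⟩
      exact h.hu x hx y hy.2 (Ne.symm hy.1) m h6 l hl h7 h8 h4 h5
    · rintro rfl
      exact ⟨⟨hl, h4⟩, h5⟩
  rw [h2, h3, Finset.sum_const, Finset.card_erase_of_mem hx]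
  have : 0 < B.card := Finset.card_pos.mpr ⟨x, hx⟩
  simp only [smul_eq_mul, mul_one]
  omega

open Classical in
lemma Res.sum_dd (h : Res q I B L) : ∑ l ∈ L, dd I B l = B.card * (q + 1) := by
  have h1 : ∑ l ∈ L, dd I B l = ∑ y ∈ B, (L.filter (fun l => I y l)).card := by
    unfold dd
    exact Finset.sum_card_bipartiteAbove_eq_sum_card_bipartiteBelow (fun l y => I y l)
  rw [h1, Finset.sum_congr rfl h.hdeg]
  simp

lemma Res.sum_dd_sq (h : Res q I B L) : ∑ l ∈ L, dd I B l ^ 2 = B.card * (q + B.card) := by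
  classical
  have h1 : ∑ l ∈ L, dd I B l ^ 2 =
      ∑ y ∈ B, ∑ l ∈ L.filter (fun l => I y l), dd I B l := by
    simp only [Finset.sum_filter]
    rw [Finset.sum_comm]
    apply Finset.sum_congr rfl
    intro l _
    rw [← Finset.sum_filter, Finset.sum_const, smul_eq_mul, sq]
    congr 1
  rw [h1, Finset.sum_congr rfl (fun y hy => h.sum_through hy)]
  simp

lemma Res.sum_u (h : Res q I B L) {x : π} (hx : x ∈ B) [DecidablePred (fun l => I x l)] :
    ∑ l ∈ L.filter (fun l => I x l), ((dd I B l : ℤ) - 1) = (B.card : ℤ) - 1 := by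
  classical
  have h1 := h.sum_through hx
  rw [Finset.sum_sub_distrib]
  have h2 := h.hdeg x hx
  have h3 : ∑ l ∈ L.filter (fun l => I x l), (dd I B l : ℤ) = q + B.card := by
    rw [← Nat.cast_sum]
    have : ∑ l ∈ L.filter (fun l => I x l), dd I B l = q + B.card := by
      convert h1
    rw [this]; push_cast; ring
  rw [h3]
  simp only [Finset.sum_const, nsmul_eq_mul, mul_one]
  have : (L.filter (fun l => I x l)).card = q + 1 := by convert h2
  rw [this]; push_cast; ring

/-- if `l` is covered by the lines in `S` (not containing `l`) then `d l ≤ |S|`. -/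
lemma Res.cover (h : Res q I B L) {l : Λ} (hl : l ∈ L) (S : Finset Λ) (hS : S ⊆ L) (hlS : l ∉ S)
    (hc : ∀ x ∈ B, I x l → ∃ m ∈ S, I x m) : dd I B l ≤ S.card := by
  classical
  have h1 : B.filter (fun x => I x l) ⊆ S.biUnion (fun m => B.filter (fun x => I x l ∧ I x m)) := by
    intro x hx
    rw [Finset.mem_filter] at hx
    obtain ⟨m, hm, h2⟩ := hc x hx.1 hx.2
    rw [Finset.mem_biUnion]
    exact ⟨m, hm, Finset.mem_filter.mpr ⟨hx.1, hx.2, h2⟩⟩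
  have h2 : dd I B l ≤ (S.biUnion (fun m => B.filter (fun x => I x l ∧ I x m))).card := by
    unfold dd
    convert Finset.card_le_card h1
  refine h2.trans ((Finset.card_biUnion_le_card_mul _ _ 1 ?_).trans (by simp))
  intro m hm
  convert h.inter_le hl (hS hm) (fun hh => hlS (hh ▸ hm))

lemma Res.sum_lines (h : Res q I B L) (S : Finset Λ) (hS : S ⊆ L) :
    ∑ l ∈ S, dd I B l ≤ B.card + S.card ^ 2 := by
  classical
  have key : ∀ S : Finset Λ, S ⊆ L →
      ∑ l ∈ S, dd I B l ≤ (B.filter (fun x => ∃ l ∈ S, I x l)).card + S.card ^ 2 := by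
    intro S
    induction S using Finset.induction_on with
    | empty => simp
    | insert l S hlS ih =>
      intro hS
      have hSL : S ⊆ L := (Finset.subset_insert _ _).trans hS
      have hl : l ∈ L := hS (Finset.mem_insert_self _ _)
      have h1 := ih hSL
      rw [Finset.sum_insert hlS, Finset.card_insert_of_notMem hlS]
      have h2 : (B.filter (fun x => I x l ∧ ∃ m ∈ S, I x m)).card ≤ S.card := by
        have h1 : B.filter (fun x => I x l ∧ ∃ m ∈ S, I x m) ⊆
            S.biUnion (fun m => B.filter (fun x => I x l ∧ I x m)) := by
          intro x hx
          rw [Finset.mem_filter] at hx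
          obtain ⟨hxB, hxl, m, hm, h2⟩ := hx
          rw [Finset.mem_biUnion]
          exact ⟨m, hm, Finset.mem_filter.mpr ⟨hxB, hxl, h2⟩⟩
        refine (Finset.card_le_card h1).trans
          ((Finset.card_biUnion_le_card_mul _ _ 1 ?_).trans (by simp))
        intro m hm
        convert h.inter_le hl (hSL hm) (fun hh => hlS (hh ▸ hm))
      have h3 : (B.filter (fun x => I x l)).card + (B.filter (fun x => ∃ m ∈ S, I x m)).card =
          (B.filter (fun x => ∃ m ∈ insert l S, I x m)).card +
          (B.filter (fun x => I x l ∧ ∃ m ∈ S, I x m)).card := by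
        rw [← Finset.card_union_add_card_inter]
        congr 2
        · ext x; simp only [Finset.mem_union, Finset.mem_filter, Finset.mem_insert]
          constructor
          · rintro (⟨h1, h2⟩ | ⟨h1, m, h2, h3⟩)
            · exact ⟨h1, l, Or.inl rfl, h2⟩
            · exact ⟨h1, m, Or.inr h2, h3⟩
          · rintro ⟨h1, m, rfl | h2, h3⟩
            · exact Or.inl ⟨h1, h3⟩
            · exact Or.inr ⟨h1, m, h2, h3⟩
        · ext x; simp only [Finset.mem_inter, Finset.mem_filter]; tauto
      have h4 : dd I B l = (B.filter (fun x => I x l)).card := by unfold dd; congr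
      rw [h4]
      nlinarith
  exact (key S hS).trans (Nat.add_le_add_right (Finset.card_filter_le _ _) _)

lemma Res.main (h : Res q I B L) (hq : 2048 ≤ q) (hτ : B.card + 135 ≤ 3 * q)
    (hB : q + 1 < B.card ∨ ∃ l ∈ L, dd I B l = 2) 
    (hsq : ∀ x ∈ B, ∀ s : Finset Λ, (∀ l, l ∈ s ↔ l ∈ L ∧ I x l) →
      (q : ℤ) ^ 2 + q + 1 - B.card ≤ ∑ l ∈ s, ((dd I B l : ℤ) - 1) ^ 2) :
    ∃ l₁ ∈ L, ∃ l₂ ∈ L, l₁ ≠ l₂ ∧ (∀ x ∈ B, I x l₁ ∨ I x l₂) ∧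
      q ≤ dd I B l₁ + 13 ∧ q ≤ dd I B l₂ + 13 := by
  classical
  obtain ⟨H, hH⟩ : ∃ H : Finset Λ, H = L.filter (fun l => q + 2 ≤ 3 * dd I B l) := ⟨_, rfl⟩
  have hHL : H ⊆ L := by rw [hH]; exact Finset.filter_subset _ _
  have hHd : ∀ l ∈ H, q + 2 ≤ 3 * dd I B l := by
    intro l hl; rw [hH, Finset.mem_filter] at hl; exact hl.2
  have hpos : ∀ x ∈ B, ∀ l, I x l → 1 ≤ dd I B l := by
    intro x hx l hl
    exact Finset.card_pos.mpr ⟨x, Finset.mem_filter.mpr ⟨hx, hl⟩⟩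
  have hqz : (2048 : ℤ) ≤ q := by exact_mod_cast hq
  have hτz : (B.card : ℤ) + 135 ≤ 3 * q := by exact_mod_cast hτ
  have hcov : ∀ x ∈ B, ∃ l ∈ H, I x l := by
    intro x hx
    by_contra hcon
    push Not at hcon
    have h1 := hsq x hx (L.filter (fun l => I x l)) (fun l => Finset.mem_filter)
    have h2 : 3 * ∑ l ∈ L.filter (fun l => I x l), ((dd I B l : ℤ) - 1) ^ 2 ≤
        ((q : ℤ) - 2) * ∑ l ∈ L.filter (fun l => I x l), ((dd I B l : ℤ) - 1) := by
      rw [Finset.mul_sum, Finset.mul_sum]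
      apply Finset.sum_le_sum
      intro l hl
      rw [Finset.mem_filter] at hl
      have h3 : ¬ (q + 2 ≤ 3 * dd I B l) := by
        intro h3
        exact hcon l (by rw [hH, Finset.mem_filter]; exact ⟨hl.1, h3⟩) hl.2
      have h4 := hpos x hx l hl.2
      have h5 : 3 * ((dd I B l : ℤ) - 1) ≤ q - 2 := by omega
      have h6 : 0 ≤ (dd I B l : ℤ) - 1 := by omega
      nlinarith
    rw [h.sum_u hx] at h2
    nlinarith
  have hH9 : H.card ≤ 9 := by
    by_contra hcon
    obtain ⟨S, hS, hSc⟩ := Finset.exists_subset_card_eq (s := H) (n := 10) (by omega)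
    have h1 := h.sum_lines S (hS.trans hHL)
    have h2 : S.card • (q + 2) ≤ ∑ l ∈ S, 3 * dd I B l :=
      Finset.card_nsmul_le_sum _ _ _ (fun l hl => hHd l (hS hl))
    rw [← Finset.mul_sum, hSc, smul_eq_mul] at h2
    rw [hSc] at h1
    omega
  have hlight : ∀ l ∈ L, l ∉ H → dd I B l ≤ 9 := by
    intro l hl hlH
    exact (h.cover hl H hHL hlH (fun x hx _ => hcov x hx)).trans hH9
  have hbig : ∀ l ∈ H, q ≤ dd I B l + 13 := by
    intro l hl
    have hpt : ∃ x ∈ B, I x l ∧ ∀ m ∈ H, m ≠ l → ¬ I x m := by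
      by_contra hcon
      push Not at hcon
      have h1 := h.cover (hHL hl) (H.erase l) ((Finset.erase_subset _ _).trans hHL)
        (Finset.notMem_erase _ _) (by
          intro x hx hxl
          obtain ⟨m, hm, h1, h2⟩ := hcon x hx hxl
          exact ⟨m, Finset.mem_erase.mpr ⟨h1, hm⟩, h2⟩)
      have h2 := Finset.card_erase_le (s := H) (a := l)
      have := hHd l hl
      omega
    obtain ⟨x, hx, hxl, hxm⟩ := hpt
    have h1 := hsq x hx (L.filter (fun l => I x l)) (fun l => Finset.mem_filter)
    have hu := h.sum_u hx
    have hlm : l ∈ L.filter (fun l => I x l) := Finset.mem_filter.mpr ⟨hHL hl, hxl⟩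
    rw [← Finset.add_sum_erase _ _ hlm] at h1 hu
    have h2 : ∑ m ∈ (L.filter (fun l => I x l)).erase l, ((dd I B m : ℤ) - 1) ^ 2 ≤
        8 * ∑ m ∈ (L.filter (fun l => I x l)).erase l, ((dd I B m : ℤ) - 1) := by
      rw [Finset.mul_sum]
      apply Finset.sum_le_sum
      intro m hm
      rw [Finset.mem_erase, Finset.mem_filter] at hm
      have h3 := hlight m hm.2.1 (fun hmH => hxm m hmH hm.1 hm.2.2)
      have h4 := hpos x hx m hm.2.2
      have h5 : (dd I B m : ℤ) - 1 ≤ 8 := by omega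
      have h6 : 0 ≤ (dd I B m : ℤ) - 1 := by omega
      nlinarith
    by_contra hlt
    have h7 : (dd I B l : ℤ) ≤ q - 14 := by omega
    have h8 : (1 : ℤ) ≤ dd I B l := by exact_mod_cast hpos x hx l hxl
    nlinarith
  have hH2 : H.card ≤ 2 := by
    by_contra hcon
    obtain ⟨S, hS, hSc⟩ := Finset.exists_subset_card_eq (s := H) (n := 3) (by omega)
    have h1 := h.sum_lines S (hS.trans hHL)
    have h2 : S.card • q ≤ ∑ l ∈ S, (dd I B l + 13) :=
      Finset.card_nsmul_le_sum _ _ _ (fun l hl => hbig l (hS hl))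
    rw [Finset.sum_add_distrib, Finset.sum_const, hSc, smul_eq_mul, smul_eq_mul] at h2
    rw [hSc] at h1
    omega
  have hne : B.Nonempty := by
    rcases hB with hB | ⟨l, hl, h2⟩
    · exact Finset.card_pos.mp (by omega)
    · have : 0 < dd I B l := by omega
      obtain ⟨x, hx⟩ := Finset.card_pos.mp this
      exact ⟨x, (Finset.mem_filter.mp hx).1⟩
  obtain ⟨x0, hx0⟩ := hne
  obtain ⟨l0, hl0, hxl0⟩ := hcov x0 hx0
  by_cases hone : ∃ l₂ ∈ H, l₂ ≠ l0
  · obtain ⟨l₂, hl2, h2⟩ := hone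
    have hHe : H = {l0, l₂} := by
      symm
      apply Finset.eq_of_subset_of_card_le
      · intro m hm
        simp only [Finset.mem_insert, Finset.mem_singleton] at hm
        rcases hm with rfl | rfl <;> assumption
      · rw [Finset.card_pair (Ne.symm h2)]; exact hH2
    refine ⟨l0, hHL hl0, l₂, hHL hl2, Ne.symm h2, ?_, hbig _ hl0, hbig _ hl2⟩
    intro x hx
    obtain ⟨l, hl, hxl⟩ := hcov x hx
    rw [hHe] at hl
    simp only [Finset.mem_insert, Finset.mem_singleton] at hl
    rcases hl with rfl | rfl
    · exact Or.inl hxl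
    · exact Or.inr hxl
  · exfalso
    push Not at hone
    have hall : ∀ x ∈ B, I x l0 := by
      intro x hx
      obtain ⟨l, hl, hxl⟩ := hcov x hx
      rwa [hone l hl] at hxl
    rcases hB with hB | ⟨l, hl, h2⟩
    · have h3 : dd I B l0 = B.card := by
        unfold dd
        rw [Finset.filter_true_of_mem hall]
      have := h.hmax l0 (hHL hl0)
      omega
    · have h3 : 1 < (B.filter (fun x => I x l)).card := by
        have : dd I B l = (B.filter (fun x => I x l)).card := by unfold dd; congr
        omega
      obtain ⟨x, hx, y, hy, hxy⟩ := Finset.one_lt_card.mp h3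
      rw [Finset.mem_filter] at hx hy
      have h4 := h.hu x hx.1 y hy.1 hxy l hl l0 (hHL hl0) hx.2 hy.2 (hall x hx.1) (hall y hy.1)
      have := hbig l0 hl0
      rw [← h4] at this
      omega


lemma Res.types (h : Res q I B L) (hq : 2048 ≤ q) (hτ : B.card + 135 ≤ 3 * q)
    (hB : q + 1 < B.card ∨ ∃ l ∈ L, dd I B l = 2)
    (hsq : ∀ x ∈ B, ∀ s : Finset Λ, (∀ l, l ∈ s ↔ l ∈ L ∧ I x l) →
      (q : ℤ) ^ 2 + q + 1 - B.card ≤ ∑ l ∈ s, ((dd I B l : ℤ) - 1) ^ 2) :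
    (B.card = 2 * q + 1 ∧ (L.filter (fun l => dd I B l = 1)).card + 1 = q) ∨
    (B.card = 2 * q ∧ (∀ l ∈ L, dd I B l ≠ 1) ∧ (L.filter (fun l => dd I B l = 0)).card + 1 = q) ∨
    (B.card = 2 * q ∧ (∀ l ∈ L, dd I B l ≠ 0) ∧
      (L.filter (fun l => dd I B l = 1)).card + 1 = 2 * q) := by
  classical
  obtain ⟨l₁, hl1, l₂, hl2, hne, hcov, hd1, hd2⟩ := h.main hq hτ hB hsq
  have hmem : ∀ m, m ∈ (L.erase l₁).erase l₂ ↔ m ∈ L ∧ m ≠ l₁ ∧ m ≠ l₂ := by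
    intro m; simp only [Finset.mem_erase]; tauto
  have hpos : ∀ x ∈ B, ∀ l, I x l → 1 ≤ dd I B l := by
    intro x hx l hl
    exact Finset.card_pos.mpr ⟨x, Finset.mem_filter.mpr ⟨hx, hl⟩⟩
  have hlight : ∀ m ∈ L, m ≠ l₁ → m ≠ l₂ → dd I B m ≤ 2 := by
    intro m hm h1 h2
    have h3 := h.cover hm {l₁, l₂}
      (by intro l hl; simp only [Finset.mem_insert, Finset.mem_singleton] at hl
          rcases hl with rfl | rfl <;> assumption)
      (by simp [h1, h2]) (by
        intro x hx _
        rcases hcov x hx with h3 | h3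
        · exact ⟨l₁, by simp, h3⟩
        · exact ⟨l₂, by simp, h3⟩)
    exact h3.trans Finset.card_le_two
  have hddf : ∀ l, dd I B l = (B.filter (fun x => I x l)).card := by
    intro l; unfold dd; congr
  have hincl : B.card + (B.filter (fun x => I x l₁ ∧ I x l₂)).card = dd I B l₁ + dd I B l₂ := by
    rw [hddf, hddf, ← Finset.card_union_add_card_inter (B.filter (fun x => I x l₁))
      (B.filter (fun x => I x l₂))]
    congr 2
    · ext x; simp only [Finset.mem_union, Finset.mem_filter]
      constructor
      · intro hx
        rcases hcov x hx with h3 | h3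
        · exact Or.inl ⟨hx, h3⟩
        · exact Or.inr ⟨hx, h3⟩
      · rintro (h3 | h3) <;> exact h3.1
    · ext x; simp only [Finset.mem_inter, Finset.mem_filter]; tauto
  have hcapInt : (B.filter (fun x => I x l₁ ∧ I x l₂)).card ≤ 1 := by
    convert h.inter_le hl1 hl2 hne
  have hqz : (2048 : ℤ) ≤ q := by exact_mod_cast hq
  have hm1 := h.hmax l₁ hl1
  have hm2 := h.hmax l₂ hl2
  have side : ∀ l ∈ L, ∀ l' ∈ L, l ≠ l' → (∀ m ∈ L, m ≠ l → m ≠ l' → dd I B m ≤ 2) →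
      q ≤ dd I B l + 13 → q ≤ dd I B l ∧ (dd I B l = q → 2 * q ≤ B.card) := by
    intro l hl l' hl' hll hlt hd
    have hpt : ∃ x ∈ B, I x l ∧ ¬ I x l' := by
      by_contra hcon
      push Not at hcon
      have h1 := h.cover hl {l'} (by simpa using hl') (by simpa using hll)
        (fun x hx hxl => ⟨l', by simp, hcon x hx hxl⟩)
      rw [Finset.card_singleton] at h1
      omega
    obtain ⟨x, hx, hxl, hxl'⟩ := hpt
    have h1 := hsq x hx (L.filter (fun l => I x l)) (fun l => Finset.mem_filter)
    have hu := h.sum_u hx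
    have hlm : l ∈ L.filter (fun l => I x l) := Finset.mem_filter.mpr ⟨hl, hxl⟩
    rw [← Finset.add_sum_erase _ _ hlm] at h1 hu
    have h2 : ∑ m ∈ (L.filter (fun l => I x l)).erase l, ((dd I B m : ℤ) - 1) ^ 2 =
        ∑ m ∈ (L.filter (fun l => I x l)).erase l, ((dd I B m : ℤ) - 1) := by
      apply Finset.sum_congr rfl
      intro m hm
      rw [Finset.mem_erase, Finset.mem_filter] at hm
      have h3 := hlt m hm.2.1 hm.1 (fun h => hxl' (h ▸ hm.2.2))
      have h4 := hpos x hx m hm.2.2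
      have h5 : dd I B m = 1 ∨ dd I B m = 2 := by omega
      rcases h5 with h5 | h5 <;> rw [h5] <;> norm_num
    rw [h2] at h1
    have h8 : (1 : ℤ) ≤ dd I B l := by exact_mod_cast hpos x hx l hxl
    have hτ2 : (B.card : ℤ) ≤ 2 * q + 2 := by
      have : B.card ≤ 2 * q + 2 := by omega
      exact_mod_cast this
    constructor
    · by_contra hlt
      have h7 : (dd I B l : ℤ) ≤ q - 1 := by omega
      nlinarith
    · intro h9
      rw [h9] at h1 hu
      have : (2 * q : ℤ) ≤ B.card := by nlinarith
      exact_mod_cast this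
  obtain ⟨ha, ha'⟩ := side l₁ hl1 l₂ hl2 hne hlight hd1
  obtain ⟨hb, hb'⟩ := side l₂ hl2 l₁ hl1 (Ne.symm hne) (fun m hm h1 h2 => hlight m hm h2 h1) hd2
  -- counting identities
  have hl2' : l₂ ∈ L.erase l₁ := Finset.mem_erase.mpr ⟨Ne.symm hne, hl2⟩
  have S1 := h.sum_dd
  rw [← Finset.add_sum_erase _ _ hl1, ← Finset.add_sum_erase _ _ hl2'] at S1
  have S2 := h.sum_dd_sq
  rw [← Finset.add_sum_erase _ _ hl1, ← Finset.add_sum_erase _ _ hl2'] at S2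
  have S0 : ((L.erase l₁).erase l₂).card + 2 = q ^ 2 + q + 1 := by
    rw [Finset.card_erase_of_mem hl2', Finset.card_erase_of_mem hl1, h.hL]
    have : 0 < q ^ 2 := by positivity
    omega
  have f1 : L.filter (fun l => dd I B l = 1) =
      ((L.erase l₁).erase l₂).filter (fun l => dd I B l = 1) := by
    ext m
    simp only [Finset.mem_filter, hmem]
    constructor
    · rintro ⟨h1, h2⟩
      refine ⟨⟨h1, ?_, ?_⟩, h2⟩ <;> rintro rfl <;> omega
    · rintro ⟨h1, h2⟩; exact ⟨h1.1, h2⟩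
  have f0 : L.filter (fun l => dd I B l = 0) =
      ((L.erase l₁).erase l₂).filter (fun l => dd I B l = 0) := by
    ext m
    simp only [Finset.mem_filter, hmem]
    constructor
    · rintro ⟨h1, h2⟩
      refine ⟨⟨h1, ?_, ?_⟩, h2⟩ <;> rintro rfl <;> omega
    · rintro ⟨h1, h2⟩; exact ⟨h1.1, h2⟩
  have N1 : (L.filter (fun l => dd I B l = 1)).card +
      ∑ l ∈ (L.erase l₁).erase l₂, dd I B l ^ 2 = 2 * ∑ l ∈ (L.erase l₁).erase l₂, dd I B l := by
    rw [f1, Finset.card_filter, ← Finset.sum_add_distrib, Finset.mul_sum]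
    apply Finset.sum_congr rfl
    intro m hm
    rw [hmem] at hm
    have := hlight m hm.1 hm.2.1 hm.2.2
    interval_cases dd I B m <;> simp
  have N0 : 2 * (L.filter (fun l => dd I B l = 0)).card +
      3 * ∑ l ∈ (L.erase l₁).erase l₂, dd I B l = 2 * ((L.erase l₁).erase l₂).card +
      ∑ l ∈ (L.erase l₁).erase l₂, dd I B l ^ 2  := by
    rw [f0, Finset.card_filter, Finset.mul_sum, Finset.mul_sum, ← Finset.sum_add_distrib,
      Finset.card_eq_sum_ones, Finset.mul_sum, ← Finset.sum_add_distrib]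
    apply Finset.sum_congr rfl
    intro m hm
    rw [hmem] at hm
    have := hlight m hm.1 hm.2.1 hm.2.2
    interval_cases dd I B m <;> simp
  have hne0 : ∀ n, (L.filter (fun l => dd I B l = n)).card = 0 → ∀ l ∈ L, dd I B l ≠ n := by
    intro n hn l hl hln
    rw [Finset.card_eq_zero] at hn
    have : l ∈ L.filter (fun l => dd I B l = n) := Finset.mem_filter.mpr ⟨hl, hln⟩
    rw [hn] at this
    simp at this
  have hfu : ∀ l ∈ L, ∀ m ∈ L, l ≠ m → dd I B l = q + 1 →
      1 ≤ (B.filter (fun x => I x l ∧ I x m)).card := by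
    intro l hl m hm hlm hd
    obtain ⟨x, hx, h1⟩ := h.hfull l hl m hm hlm hd
    exact Finset.card_pos.mpr ⟨x, Finset.mem_filter.mpr ⟨hx, h1⟩⟩
  have hcomm : (B.filter (fun x => I x l₂ ∧ I x l₁)).card =
      (B.filter (fun x => I x l₁ ∧ I x l₂)).card := by
    simp only [and_comm]
  generalize (∑ l ∈ (L.erase l₁).erase l₂, dd I B l) = s1 at *
  generalize (∑ l ∈ (L.erase l₁).erase l₂, dd I B l ^ 2) = s2 at *
  generalize ((L.erase l₁).erase l₂).card = s0 at *
  have ha2 : dd I B l₁ = q ∨ dd I B l₁ = q + 1 := by omega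
  have hb2 : dd I B l₂ = q ∨ dd I B l₂ = q + 1 := by omega
  rcases ha2 with ha2 | ha2 <;> rcases hb2 with hb2 | hb2
  · right; left
    have hc : B.card = 2 * q := by
      have := ha' ha2
      omega
    rw [ha2, hb2, hc] at S1 S2
    refine ⟨hc, hne0 1 ?_, ?_⟩
    · zify at *; linarith
    · zify at *; linarith
  · right; right
    have h1 := hfu l₂ hl2 l₁ hl1 (Ne.symm hne) hb2
    have hc : B.card = 2 * q := by omega
    rw [ha2, hb2, hc] at S1 S2
    refine ⟨hc, hne0 0 ?_, ?_⟩
    · zify at *; linarith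
    · zify at *; linarith
  · right; right
    have h1 := hfu l₁ hl1 l₂ hl2 hne ha2
    have hc : B.card = 2 * q := by omega
    rw [ha2, hb2, hc] at S1 S2
    refine ⟨hc, hne0 0 ?_, ?_⟩
    · zify at *; linarith
    · zify at *; linarith
  · left
    have h1 := hfu l₁ hl1 l₂ hl2 hne ha2
    have hc : B.card = 2 * q + 1 := by omega
    rw [ha2, hb2, hc] at S1 S2
    refine ⟨hc, ?_⟩
    zify at *; linarith

end residue


set_option linter.unusedSectionVars false

section geom
open Module

variable {F : Type*} [Field F] [Fintype F] {V : Type*} [AddCommGroup V] [Module F V]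
  [FiniteDimensional F V] [Finite V]

/-- subspaces between `A` and `B` of rank `n` -/
noncomputable def subs (A B : Submodule F V) (n : ℕ) : Finset (Submodule F V) :=
  (Set.toFinite {W : Submodule F V | A ≤ W ∧ W ≤ B ∧ finrank F W = n}).toFinset

lemma mem_subs {A B W : Submodule F V} {n : ℕ} :
    W ∈ subs A B n ↔ A ≤ W ∧ W ≤ B ∧ finrank F W = n := by
  unfold subs; simp

open Classical in
/-- number of points of `C` in `W` -/
noncomputable def mm (C : Finset (Submodule F V)) (W : Submodule F V) : ℕ :=
  (C.filter (fun P => P ≤ W)).card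

def Cap (C : Finset (Submodule F V)) : Prop :=
  (∀ P ∈ C, finrank F P = 1) ∧
  ∀ P ∈ C, ∀ Q ∈ C, ∀ S ∈ C, P ≠ Q → P ≠ S → Q ≠ S → ¬ S ≤ P ⊔ Q

set_option maxHeartbeats 1000000 in
lemma card_cov {A B : Submodule F V} (hAB : A ≤ B) :
    (subs A B (finrank F A + 1)).card * (Fintype.card F ^ (finrank F A + 1) -
      Fintype.card F ^ (finrank F A)) = Fintype.card F ^ (finrank F B) -
      Fintype.card F ^ (finrank F A) := by
  classical
  have := Fintype.ofFinite V
  have hcard : ∀ W : Submodule F V, A ≤ W →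
      (Finset.univ.filter (fun v => v ∈ W ∧ v ∉ A)).card =
        Fintype.card F ^ (finrank F W) - Fintype.card F ^ (finrank F A) := by
    intro W hW
    have hc : ∀ W : Submodule F V, (Finset.univ.filter (fun v => v ∈ W)).card =
        Fintype.card F ^ (finrank F W) := by
      intro W
      rw [← Module.card_eq_pow_finrank (K := F) (V := W), Fintype.card_subtype]
    have h1 : (Finset.univ.filter (fun v => v ∈ W ∧ v ∉ A)) =
        (Finset.univ.filter (fun v => v ∈ W)) \ (Finset.univ.filter (fun v => v ∈ A)) := by
      ext v; simp
    rw [h1, Finset.card_sdiff_of_subset, hc, hc]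
    intro v hv
    simp only [Finset.mem_filter, Finset.mem_univ, true_and] at hv ⊢
    exact hW hv
  rw [← hcard B hAB]
  rw [Finset.card_eq_sum_card_fiberwise (f := fun v => A ⊔ Submodule.span F {v})
    (t := subs A B (finrank F A + 1))]
  · rw [Finset.sum_congr rfl (g := fun _ => Fintype.card F ^ (finrank F A + 1) -
      Fintype.card F ^ (finrank F A)), Finset.sum_const, smul_eq_mul]
    intro W hW
    rw [mem_subs] at hW
    rw [← hW.2.2, ← hcard W hW.1]
    congr 1
    ext v
    simp only [Finset.mem_filter, Finset.mem_univ, true_and]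
    constructor
    · rintro ⟨⟨h1, h2⟩, rfl⟩
      exact ⟨Submodule.mem_sup_right (Submodule.mem_span_singleton_self v), h2⟩
    · rintro ⟨h1, h2⟩
      refine ⟨⟨hW.2.1 h1, h2⟩, ?_⟩
      have h0 : v ≠ 0 := by rintro rfl; exact h2 (Submodule.zero_mem _)
      apply Submodule.eq_of_le_of_finrank_le
      · exact sup_le hW.1 (by rwa [Submodule.span_singleton_le_iff_mem])
      · rw [finrank_sup_pt (finrank_span_singleton h0)
          (by rwa [Submodule.span_singleton_le_iff_mem])]
        omega
  · intro v hv
    simp only [Finset.coe_filter, Finset.mem_univ, true_and, Set.mem_ofPred_eq] at hv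
    have h0 : v ≠ 0 := by rintro rfl; exact hv.2 (Submodule.zero_mem _)
    rw [Finset.mem_coe, mem_subs]
    refine ⟨le_sup_left, sup_le hAB ?_, ?_⟩
    · rw [Submodule.span_singleton_le_iff_mem]; exact hv.1
    · exact finrank_sup_pt (finrank_span_singleton h0)
          (by rw [Submodule.span_singleton_le_iff_mem]; exact hv.2)

lemma card_cov2 {A B : Submodule F V} (hAB : A ≤ B) {n : ℕ} (hn : n = finrank F A + 1)
    (h : finrank F B = finrank F A + 2) : (subs A B n).card = Fintype.card F + 1 := by
  have h1 := card_cov hAB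
  have hq : 1 < Fintype.card F := Fintype.one_lt_card
  rw [h, ← hn] at h1
  generalize (subs A B n).card = N at *
  generalize Fintype.card F = q at *
  obtain ⟨p, rfl⟩ := Nat.exists_eq_add_of_lt hq
  have h2 : 0 < (1 + p + 1) ^ finrank F A := by positivity
  subst hn
  have e1 : (1 + p + 1) ^ (finrank F A + 1) - (1 + p + 1) ^ finrank F A =
      (1 + p + 1) ^ finrank F A * (p + 1) := by
    rw [pow_succ]; apply Nat.sub_eq_of_eq_add; ring
  have e2 : (1 + p + 1) ^ (finrank F A + 2) - (1 + p + 1) ^ finrank F A =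
      (1 + p + 1) ^ finrank F A * ((p + 1) * (1 + p + 1 + 1)) := by
    rw [pow_add]; apply Nat.sub_eq_of_eq_add; ring
  rw [e1, e2] at h1
  have h3 : 0 < (1 + p + 1) ^ finrank F A * (p + 1) := by positivity
  apply Nat.eq_of_mul_eq_mul_right h3
  rw [h1]; ring

lemma card_cov3 {A B : Submodule F V} (hAB : A ≤ B) {n : ℕ} (hn : n = finrank F A + 1)
    (h : finrank F B = finrank F A + 3) :
    (subs A B n).card = Fintype.card F ^ 2 + Fintype.card F + 1 := by
  have h1 := card_cov hAB
  have hq : 1 < Fintype.card F := Fintype.one_lt_card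
  rw [h, ← hn] at h1
  generalize (subs A B n).card = N at *
  generalize Fintype.card F = q at *
  obtain ⟨p, rfl⟩ := Nat.exists_eq_add_of_lt hq
  have h2 : 0 < (1 + p + 1) ^ finrank F A := by positivity
  subst hn
  have e1 : (1 + p + 1) ^ (finrank F A + 1) - (1 + p + 1) ^ finrank F A =
      (1 + p + 1) ^ finrank F A * (p + 1) := by
    rw [pow_succ]; apply Nat.sub_eq_of_eq_add; ring
  have e2 : (1 + p + 1) ^ (finrank F A + 3) - (1 + p + 1) ^ finrank F A =
      (1 + p + 1) ^ finrank F A * ((p + 1) * ((1 + p + 1) ^ 2 + (1 + p + 1) + 1)) := by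
    rw [pow_add]; apply Nat.sub_eq_of_eq_add; ring
  rw [e1, e2] at h1
  have h3 : 0 < (1 + p + 1) ^ finrank F A * (p + 1) := by positivity
  apply Nat.eq_of_mul_eq_mul_right h3
  rw [h1]; ring

lemma sum_cov {A D : Submodule F V} {n : ℕ} (hn : n = finrank F A + 1) (hAD : A ≤ D)
    (C : Finset (Submodule F V)) (hC : ∀ P ∈ C, finrank F P = 1) (hCD : ∀ P ∈ C, P ≤ D) :
    ∑ W ∈ subs A D n, mm C W + mm C A = C.card + (subs A D n).card * mm C A := by
  classical
  have h1 : ∑ W ∈ subs A D n, mm C W =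
      ∑ P ∈ C, ((subs A D n).filter (fun W => P ≤ W)).card := by
    have := Finset.sum_card_bipartiteAbove_eq_sum_card_bipartiteBelow (s := subs A D n) (t := C)
      (fun W P => P ≤ W)
    unfold Finset.bipartiteAbove Finset.bipartiteBelow at this
    unfold mm
    convert this
  have h2 : ∀ P ∈ C, ((subs A D n).filter (fun W => P ≤ W)).card + (if P ≤ A then 1 else 0) =
      1 + (if P ≤ A then (subs A D n).card else 0) := by
    intro P hP
    split_ifs with h
    · rw [Finset.filter_true_of_mem, add_comm]
      intro W hW
      exact h.trans (mem_subs.mp hW).1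
    · rw [add_zero, add_zero, Finset.card_eq_one]
      refine ⟨A ⊔ P, ?_⟩
      ext W
      rw [Finset.mem_filter, mem_subs, Finset.mem_singleton]
      constructor
      · rintro ⟨⟨h3, h4, h5⟩, h6⟩
        symm
        apply Submodule.eq_of_le_of_finrank_le (sup_le h3 h6)
        rw [finrank_sup_pt (hC P hP) h]; omega
      · rintro rfl
        refine ⟨⟨le_sup_left, sup_le hAD (hCD P hP), ?_⟩, le_sup_right⟩
        rw [finrank_sup_pt (hC P hP) h]; omega
  have h3 := Finset.sum_congr (rfl : C = C) h2
  rw [Finset.sum_add_distrib, Finset.sum_add_distrib, ← h1, ← Finset.card_filter,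
    ← Finset.card_eq_sum_ones, ← Finset.sum_filter, Finset.sum_const, smul_eq_mul] at h3
  have h4 : mm C A = (C.filter (fun P => P ≤ A)).card := by unfold mm; congr
  rw [h4, h3, mul_comm]

lemma mm_secant {C : Finset (Submodule F V)} (hC : Cap C) {R R' : Submodule F V} (hR : R ∈ C)
    (hR' : R' ∈ C) (hRR : R ≠ R') : mm C (R ⊔ R') = 2 := by
  classical
  unfold mm
  rw [Finset.card_eq_two]
  refine ⟨R, R', hRR, ?_⟩
  ext P
  simp only [Finset.mem_filter, Finset.mem_insert, Finset.mem_singleton]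
  constructor
  · rintro ⟨h1, h2⟩
    by_contra hcon
    push Not at hcon
    exact hC.2 R hR R' hR' P h1 hRR (Ne.symm hcon.1) (Ne.symm hcon.2) h2
  · rintro (rfl | rfl)
    · exact ⟨hR, le_sup_left⟩
    · exact ⟨hR', le_sup_right⟩

/-- Segre bound summed over all planes on a secant through `Z`. -/
lemma segre_sum [CharP F 2] {D : Submodule F V}
    {C U : Finset (Submodule F V)} (hC : Cap C) (hCD : ∀ P ∈ C, P ≤ D)
    {R R' Z : Submodule F V} (hR : R ∈ C) (hR' : R' ∈ C) (hRR : R ≠ R')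
    (hZ : finrank F Z = 1) (hZR : Z ≤ R ⊔ R') (hZC : Z ∉ C) (hUC : U ⊆ C)
    (hU : ∀ P ∈ U, ∀ S ∈ C, S ≠ P → ¬ S ≤ Z ⊔ P) :
    U.card + C.card + 2 * (subs (R ⊔ R') D 3).card ≤
      (subs (R ⊔ R') D 3).card * (Fintype.card F + 2) + 2 := by
  classical
  have hL := finrank_line (hC.1 R hR) (hC.1 R' hR') hRR
  have hLD : R ⊔ R' ≤ D := sup_le (hCD R hR) (hCD R' hR')
  have h1 := sum_cov (n := 3) (by omega) hLD C hC.1 hCD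
  have h2 := sum_cov (n := 3) (by omega) hLD U (fun P hP => hC.1 P (hUC hP))
    (fun P hP => hCD P (hUC hP))
  rw [mm_secant hC hR hR' hRR] at h1
  have hU0 : mm U (R ⊔ R') = 0 := by
    unfold mm
    rw [Finset.card_eq_zero, Finset.filter_eq_empty_iff]
    intro P hP hPL
    have hZR1 : ¬ Z ≤ R := fun h => hZC (pt_le_eq hZ (hC.1 R hR) h ▸ hR)
    have hZR2 : ¬ Z ≤ R' := fun h => hZC (pt_le_eq hZ (hC.1 R' hR') h ▸ hR')
    by_cases hPR : P = R
    · subst hPR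
      apply hU P hP R' hR' (Ne.symm hRR)
      rw [sup_comm, exchange hZ (hC.1 R' hR') hZR1 hZR]
      exact le_sup_right
    by_cases hPR' : P = R'
    · subst hPR'
      apply hU P hP R hR hRR
      rw [sup_comm, exchange hZ (hC.1 R hR) hZR2 (by rwa [sup_comm])]
      exact le_sup_right
    exact hC.2 R hR R' hR' P (hUC hP) hRR (Ne.symm hPR) (Ne.symm hPR') hPL
  rw [hU0] at h2
  have h3 : ∑ W ∈ subs (R ⊔ R') D 3, (mm U W + mm C W) ≤
      (subs (R ⊔ R') D 3).card • (Fintype.card F + 2) := by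
    apply Finset.sum_le_card_nsmul
    intro W hW
    rw [mem_subs] at hW
    have key := segre_plane hW.2.2 (C.filter (fun P => P ≤ W)) (U.filter (fun P => P ≤ W))
      (fun P hP => hC.1 P (Finset.mem_filter.mp hP).1)
      (fun P hP => (Finset.mem_filter.mp hP).2)
      (fun P hP Q hQ S hS => hC.2 P (Finset.mem_filter.mp hP).1 Q (Finset.mem_filter.mp hQ).1
        S (Finset.mem_filter.mp hS).1)
      (Finset.mem_filter.mpr ⟨hR, le_sup_left.trans hW.1⟩)
      (Finset.mem_filter.mpr ⟨hR', le_sup_right.trans hW.1⟩) hRR hZ hZR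
      (fun h => hZC (Finset.mem_filter.mp h).1) (Finset.filter_subset_filter _ hUC)
      (fun P hP S hS => hU P (Finset.mem_filter.mp hP).1 S (Finset.mem_filter.mp hS).1)
    unfold mm
    convert key
  rw [Finset.sum_add_distrib, smul_eq_mul] at h3
  omega

end geom


set_option linter.unusedSectionVars false

section capthree
open Module

variable {F : Type*} [Field F] [Fintype F] {V : Type*} [AddCommGroup V] [Module F V]
  [FiniteDimensional F V] [Finite V]

/-- tangent lines at `P` inside `W` -/
noncomputable def tg (C : Finset (Submodule F V)) (P W : Submodule F V) :
    Finset (Submodule F V) :=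
  (subs P W 2).filter (fun T => mm C T = 1)

lemma mem_tg {C : Finset (Submodule F V)} {P W T : Submodule F V} :
    T ∈ tg C P W ↔ (P ≤ T ∧ T ≤ W ∧ finrank F T = 2) ∧ mm C T = 1 := by
  unfold tg; rw [Finset.mem_filter, mem_subs]

lemma mm_one {C : Finset (Submodule F V)} {P T : Submodule F V} (hP : P ∈ C) (hPT : P ≤ T) :
    mm C T = 1 ↔ ∀ S ∈ C, S ≤ T → S = P := by
  classical
  unfold mm
  rw [Finset.card_eq_one]
  constructor
  · rintro ⟨a, ha⟩ S hS hST
    have h1 : S ∈ ({a} : Finset (Submodule F V)) := by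
      rw [← ha]; exact Finset.mem_filter.mpr ⟨hS, hST⟩
    have h2 : P ∈ ({a} : Finset (Submodule F V)) := by
      rw [← ha]; exact Finset.mem_filter.mpr ⟨hP, hPT⟩
    rw [Finset.mem_singleton] at h1 h2
    rw [h1, h2]
  · intro h
    refine ⟨P, ?_⟩
    ext S
    rw [Finset.mem_filter, Finset.mem_singleton]
    exact ⟨fun h1 => h S h1.1 h1.2, fun h1 => h1 ▸ ⟨hP, hPT⟩⟩

lemma mm_pos {C : Finset (Submodule F V)} {P T : Submodule F V} (hP : P ∈ C) (hPT : P ≤ T) :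
    1 ≤ mm C T := by
  classical
  unfold mm
  exact Finset.card_pos.mpr ⟨P, Finset.mem_filter.mpr ⟨hP, hPT⟩⟩

lemma mm_line_le {C : Finset (Submodule F V)} (hC : Cap C) {T : Submodule F V}
    (hT : finrank F T = 2) : mm C T ≤ 2 := by
  classical
  by_contra hcon
  unfold mm at hcon
  push Not at hcon
  obtain ⟨a, b, c, ha, hb, hc, hab, hac, hbc⟩ := Finset.two_lt_card_iff.mp hcon
  rw [Finset.mem_filter] at ha hb hc
  apply hC.2 a ha.1 b hb.1 c hc.1 hab hac hbc
  have : a ⊔ b = T := by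
    apply Submodule.eq_of_le_of_finrank_le (sup_le ha.2 hb.2)
    rw [finrank_line (hC.1 a ha.1) (hC.1 b hb.1) hab, hT]
  rw [this]; exact hc.2

lemma tg_count {C : Finset (Submodule F V)} (hC : Cap C) {P W : Submodule F V} (hP : P ∈ C)
    (hPW : P ≤ W) : (tg C P W).card + mm C W = (subs P W 2).card + 1 := by
  classical
  have h1 := sum_cov (n := 2) (by rw [hC.1 P hP]) hPW (C.filter (fun S => S ≤ W))
    (fun S hS => hC.1 S (Finset.mem_filter.mp hS).1) (fun S hS => (Finset.mem_filter.mp hS).2)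
  have h2 : ∀ T, T ≤ W → mm (C.filter (fun S => S ≤ W)) T = mm C T := by
    intro T hT
    unfold mm
    rw [Finset.filter_filter]
    congr 1
    ext S
    simp only [Finset.mem_filter]
    exact ⟨fun h => ⟨h.1, h.2.2⟩, fun h => ⟨h.1, h.2.trans hT, h.2⟩⟩
  have h3 : mm C P = 1 := by
    rw [mm_one hP le_rfl]
    intro S hS hSP
    exact pt_le_eq (hC.1 S hS) (hC.1 P hP) hSP
  have h4 : (C.filter (fun S => S ≤ W)).card = mm C W := by unfold mm; congr
  rw [h2 P hPW, h3, h4, Finset.sum_congr rfl (fun T hT => h2 T (mem_subs.mp hT).2.1)] at h1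
  have h5 : (tg C P W).card + ∑ T ∈ subs P W 2, mm C T = ∑ T ∈ subs P W 2, 2 := by
    unfold tg
    rw [Finset.card_filter, ← Finset.sum_add_distrib]
    apply Finset.sum_congr rfl
    intro T hT
    rw [mem_subs] at hT
    have h6 := mm_line_le hC hT.2.2
    have h7 := mm_pos hP hT.1
    have h8 : mm C T = 1 ∨ mm C T = 2 := by omega
    rcases h8 with h8 | h8 <;> rw [h8] <;> simp
  rw [Finset.sum_const, smul_eq_mul] at h5
  change ∑ T ∈ subs P W 2, mm C T + 1 = _ at h1
  omega

structure CC (C : Finset (Submodule F V)) (D : Submodule F V) : Prop where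
  cap : Cap C
  le : ∀ P ∈ C, P ≤ D
  rk : finrank F D = 4
  comp : ∀ Z : Submodule F V, finrank F Z = 1 → Z ≤ D → Z ∉ C →
    ∃ R ∈ C, ∃ R' ∈ C, R ≠ R' ∧ Z ≤ R ⊔ R'

variable {C : Finset (Submodule F V)} {D : Submodule F V}

lemma CC.tX_le [CharP F 2] (h : CC C D) {Z : Submodule F V} (hZ : finrank F Z = 1) (hZD : Z ≤ D)
    (hZC : Z ∉ C) (U : Finset (Submodule F V)) (hUC : U ⊆ C)
    (hU : ∀ P ∈ U, ∀ S ∈ C, S ≠ P → ¬ S ≤ Z ⊔ P) :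
    U.card + C.card ≤ Fintype.card F ^ 2 + Fintype.card F + 2 := by
  obtain ⟨R, hR, R', hR', hRR, hZR⟩ := h.comp Z hZ hZD hZC
  have h1 := segre_sum h.cap h.le hR hR' hRR hZ hZR hZC hUC hU
  have hL := finrank_line (h.cap.1 R hR) (h.cap.1 R' hR') hRR
  rw [card_cov2 (sup_le (h.le R hR) (h.le R' hR')) (by omega) (by rw [h.rk, hL])] at h1
  nlinarith

lemma mm_plane (hC : Cap C) {P W : Submodule F V} (hP : P ∈ C) (hPW : P ≤ W)
    (hW : finrank F W = 3) : (tg C P W).card + mm C W = Fintype.card F + 2 := by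
  rw [tg_count hC hP hPW, card_cov2 hPW (by rw [hC.1 P hP]) (by rw [hC.1 P hP, hW])]

lemma CC.tau (h : CC C D) {P : Submodule F V} (hP : P ∈ C) :
    (tg C P D).card + C.card = Fintype.card F ^ 2 + Fintype.card F + 2 := by
  classical
  have h1 := tg_count h.cap hP (h.le P hP)
  rw [card_cov3 (h.le P hP) (by rw [h.cap.1 P hP]) (by rw [h.cap.1 P hP, h.rk])] at h1
  have h2 : mm C D = C.card := by
    unfold mm
    rw [Finset.filter_true_of_mem h.le]
  omega

lemma CC.tangent_ineq [CharP F 2] (h : CC C D) {P T : Submodule F V} (hP : P ∈ C)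
    (hT : T ∈ tg C P D) :
    ∑ α ∈ subs T D 3, ((mm C α : ℤ) - 1) * ((Fintype.card F : ℤ) + 2 - mm C α) ≤
      Fintype.card F * (((tg C P D).card : ℤ) - 1) := by
  classical
  have hτ := h.tau hP
  rw [mem_tg] at hT
  obtain ⟨⟨hPT, hTD, hT2⟩, hT1⟩ := hT
  rw [mm_one hP hPT] at hT1
  have hP1 := h.cap.1 P hP
  obtain ⟨Ys, hYs⟩ : ∃ Ys, Ys = (subs (⊥ : Submodule F V) T 1).erase P := ⟨_, rfl⟩
  have hYc : Ys.card = Fintype.card F := by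
    rw [hYs, Finset.card_erase_of_mem (mem_subs.mpr ⟨bot_le, hPT, hP1⟩),
      card_cov2 bot_le (by simp) (by simp [hT2])]
    rfl
  have hYm : ∀ Y, Y ∈ Ys ↔ Y ≠ P ∧ Y ≤ T ∧ finrank F Y = 1 := by
    intro Y
    rw [hYs, Finset.mem_erase, mem_subs]
    simp
  obtain ⟨rel, hrel⟩ : ∃ rel : Submodule F V → Submodule F V → Prop,
    rel = fun Y Q => ∀ S ∈ C, S ≠ Q → ¬ S ≤ Y ⊔ Q := ⟨_, rfl⟩
  have upper : ∀ Y ∈ Ys, (((C.erase P).filter (fun Q => rel Y Q)).card : ℤ) ≤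
      ((tg C P D).card : ℤ) - 1 := by
    intro Y hY
    rw [hYm] at hY
    obtain ⟨hYP, hYT, hY1⟩ := hY
    have hYC : Y ∉ C := fun hc => hYP (hT1 Y hc hYT)
    have h1 := h.tX_le hY1 (hYT.trans hTD) hYC (C.filter (fun Q => rel Y Q))
      (Finset.filter_subset _ _) (by
        intro Q hQ S hS hSQ
        rw [Finset.mem_filter, hrel] at hQ
        exact hQ.2 S hS hSQ)
    have h2 : (C.erase P).filter (fun Q => rel Y Q) = (C.filter (fun Q => rel Y Q)).erase P := by
      ext Q; simp only [Finset.mem_filter, Finset.mem_erase]; tauto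
    have h3 : P ∈ C.filter (fun Q => rel Y Q) := by
      rw [Finset.mem_filter, hrel]
      refine ⟨hP, fun S hS hSP hSY => hSP (hT1 S hS (hSY.trans (sup_le hYT hPT)))⟩
    have h4 := Finset.card_erase_add_one h3
    rw [h2]
    omega
  have hQT : ∀ Q ∈ C.erase P, ¬ Q ≤ T := by
    intro Q hQ hc
    rw [Finset.mem_erase] at hQ
    exact hQ.1 (hT1 Q hQ.2 hc)
  have lower : ∀ Q ∈ C.erase P, (Fintype.card F : ℤ) + 2 - mm C (T ⊔ Q) ≤
      ((Ys.filter (fun Y => rel Y Q)).card : ℤ) := by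
    intro Q hQ
    have hQT' := hQT Q hQ
    rw [Finset.mem_erase] at hQ
    have hQ1 := h.cap.1 Q hQ.2
    have hα : finrank F ↥(T ⊔ Q) = 3 := by rw [finrank_sup_pt hQ1 hQT', hT2]
    have h1 := mm_plane h.cap hQ.2 (le_sup_right : Q ≤ T ⊔ Q) hα
    have hinf : ∀ l ∈ tg C Q (T ⊔ Q), finrank F ↥(l ⊓ T) = 1 ∧ l = (l ⊓ T) ⊔ Q := by
      intro l hl
      rw [mem_tg] at hl
      obtain ⟨⟨hQl, hlα, hl2⟩, hl1⟩ := hl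
      have h5 : l ⊔ T = T ⊔ Q := le_antisymm (sup_le hlα le_sup_left)
        (sup_le le_sup_right (hQl.trans le_sup_left))
      have h6 := Submodule.finrank_sup_add_finrank_inf_eq l T
      rw [h5, hα, hl2, hT2] at h6
      have h7 : finrank F ↥(l ⊓ T) = 1 := by omega
      refine ⟨h7, ?_⟩
      symm
      apply Submodule.eq_of_le_of_finrank_le (sup_le inf_le_left hQl)
      rw [finrank_line h7 hQ1 (fun hc => hQT' (hc ▸ inf_le_right)), hl2]
    have h2 : (tg C Q (T ⊔ Q)).card ≤ (Ys.filter (fun Y => rel Y Q)).card := by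
      apply Finset.card_le_card_of_injOn (fun l => l ⊓ T)
      · intro l hl
        have hl' := hl
        rw [Finset.mem_coe, mem_tg] at hl
        obtain ⟨⟨hQl, hlα, hl2⟩, hl1⟩ := hl
        rw [mm_one hQ.2 hQl] at hl1
        obtain ⟨h7, h8⟩ := hinf l hl'
        rw [Finset.mem_coe, Finset.mem_filter, hYm, hrel]
        refine ⟨⟨?_, inf_le_right, h7⟩, ?_⟩
        · intro hc
          apply hQ.1
          symm
          apply hl1 P hP
          rw [← hc]; exact inf_le_left
        · intro S hS hSQ hSl
          rw [← h8] at hSl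
          exact hSQ (hl1 S hS hSl)
      · intro l hl l' hl' hll
        simp only at hll
        rw [(hinf l hl).2, (hinf l' hl').2, hll]
    omega
  have hdc : ∑ Y ∈ Ys, ((C.erase P).filter (fun Q => rel Y Q)).card =
      ∑ Q ∈ C.erase P, (Ys.filter (fun Y => rel Y Q)).card :=
    Finset.sum_card_bipartiteAbove_eq_sum_card_bipartiteBelow rel
  have hfib : ∑ Q ∈ C.erase P, ((Fintype.card F : ℤ) + 2 - mm C (T ⊔ Q)) =
      ∑ α ∈ subs T D 3, ((mm C α : ℤ) - 1) * ((Fintype.card F : ℤ) + 2 - mm C α) := by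
    rw [← Finset.sum_fiberwise_of_maps_to (g := fun Q => T ⊔ Q) (t := subs T D 3)]
    · apply Finset.sum_congr rfl
      intro α hα
      rw [mem_subs] at hα
      rw [Finset.sum_congr rfl (g := fun _ => ((Fintype.card F : ℤ) + 2 - mm C α)),
        Finset.sum_const, nsmul_eq_mul]
      · congr 1
        have h1 : (C.erase P).filter (fun Q => T ⊔ Q = α) =
            (C.filter (fun Q => Q ≤ α)).erase P := by
          ext Q
          simp only [Finset.mem_filter, Finset.mem_erase]
          constructor
          · rintro ⟨⟨h1, h2⟩, rfl⟩
            exact ⟨h1, h2, le_sup_right⟩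
          · rintro ⟨h1, h2, h3⟩
            refine ⟨⟨h1, h2⟩, ?_⟩
            apply Submodule.eq_of_le_of_finrank_le (sup_le hα.1 h3)
            rw [finrank_sup_pt (h.cap.1 Q h2) (hQT Q (Finset.mem_erase.mpr ⟨h1, h2⟩)), hα.2.2, hT2]
        have h2 : P ∈ C.filter (fun Q => Q ≤ α) := Finset.mem_filter.mpr ⟨hP, hPT.trans hα.1⟩
        have h3 := Finset.card_erase_add_one h2
        have h4 : (C.filter (fun S => S ≤ α)).card = mm C α := by unfold mm; congr
        rw [h1]
        omega
      · intro Q hQ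
        rw [(Finset.mem_filter.mp hQ).2]
    · intro Q hQ
      have hQ' := Finset.mem_of_mem_erase hQ
      rw [mem_subs]
      refine ⟨le_sup_left, sup_le hTD (h.le Q hQ'), ?_⟩
      rw [finrank_sup_pt (h.cap.1 Q hQ') (hQT Q hQ), hT2]
  rw [← hfib]
  calc _ ≤ ∑ Q ∈ C.erase P, ((Ys.filter (fun Y => rel Y Q)).card : ℤ) := Finset.sum_le_sum lower
    _ = ∑ Y ∈ Ys, (((C.erase P).filter (fun Q => rel Y Q)).card : ℤ) := by
        rw [← Nat.cast_sum, ← Nat.cast_sum, hdc]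
    _ ≤ Ys.card • (((tg C P D).card : ℤ) - 1) := Finset.sum_le_card_nsmul _ _ _ upper
    _ = _ := by rw [hYc, nsmul_eq_mul]

end capthree


set_option linter.unusedSectionVars false

section capthree2
open Module

variable {F : Type*} [Field F] [Fintype F] {V : Type*} [AddCommGroup V] [Module F V]
  [FiniteDimensional F V] [Finite V]
variable {C : Finset (Submodule F V)} {D : Submodule F V}

lemma card_planes {P D : Submodule F V} (hP : finrank F P = 1) (hPD : P ≤ D)
    (hD : finrank F D = 4) : (subs P D 3).card = Fintype.card F ^ 2 + Fintype.card F + 1 := by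
  classical
  have hdc : ∑ W ∈ subs P D 3, ((subs P D 2).filter (fun T => T ≤ W)).card =
      ∑ T ∈ subs P D 2, ((subs P D 3).filter (fun W => T ≤ W)).card :=
    Finset.sum_card_bipartiteAbove_eq_sum_card_bipartiteBelow (fun W T => T ≤ W)
  have h1 : ∀ W ∈ subs P D 3, ((subs P D 2).filter (fun T => T ≤ W)).card =
      Fintype.card F + 1 := by
    intro W hW
    rw [mem_subs] at hW
    rw [← card_cov2 (n := 2) hW.1 (by rw [hP]) (by rw [hP, hW.2.2])]
    congr 1
    ext T
    simp only [Finset.mem_filter, mem_subs]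
    exact ⟨fun h => ⟨h.1.1, h.2, h.1.2.2⟩, fun h => ⟨⟨h.1, h.2.1.trans hW.2.1, h.2.2⟩, h.2.1⟩⟩
  have h2 : ∀ T ∈ subs P D 2, ((subs P D 3).filter (fun W => T ≤ W)).card =
      Fintype.card F + 1 := by
    intro T hT
    rw [mem_subs] at hT
    rw [← card_cov2 (n := 3) hT.2.1 (by rw [hT.2.2]) (by rw [hT.2.2, hD])]
    congr 1
    ext W
    simp only [Finset.mem_filter, mem_subs]
    exact ⟨fun h => ⟨h.2, h.1.2⟩, fun h => ⟨⟨hT.1.trans h.1, h.2⟩, h.1⟩⟩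
  rw [Finset.sum_congr rfl h1, Finset.sum_congr rfl h2, Finset.sum_const, Finset.sum_const,
    smul_eq_mul, smul_eq_mul, card_cov3 (n := 2) hPD (by rw [hP]) (by rw [hP, hD])] at hdc
  exact Nat.eq_of_mul_eq_mul_right (Nat.succ_pos _) hdc

lemma dd_tg {P W : Submodule F V} (hWD : W ≤ D) :
    dd (fun T W : Submodule F V => T ≤ W) (tg C P D) W = (tg C P W).card := by
  classical
  unfold dd
  congr 1
  ext T
  simp only [Finset.mem_filter, mem_tg]
  exact ⟨fun h => ⟨⟨h.1.1.1, h.2, h.1.1.2.2⟩, h.1.2⟩,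
    fun h => ⟨⟨⟨h.1.1, h.1.2.1.trans hWD, h.1.2.2⟩, h.2⟩, h.1.2.1⟩⟩

lemma sup_lines {T T' W : Submodule F V} (hT : finrank F T = 2) (hT' : finrank F T' = 2)
    (hne : T ≠ T') (hW : finrank F W = 3) (h1 : T ≤ W) (h2 : T' ≤ W) : T ⊔ T' = W := by
  apply Submodule.eq_of_le_of_finrank_le (sup_le h1 h2)
  by_contra hcon
  push Not at hcon
  have h3 : T = T ⊔ T' := Submodule.eq_of_le_of_finrank_le le_sup_left (by omega)
  have h4 : T' = T ⊔ T' := Submodule.eq_of_le_of_finrank_le le_sup_right (by omega)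
  exact hne (h3.trans h4.symm)

lemma CC.res (h : CC C D) {P : Submodule F V} (hP : P ∈ C) :
    Res (Fintype.card F) (fun T W : Submodule F V => T ≤ W) (tg C P D) (subs P D 3) := by
  classical
  have hP1 := h.cap.1 P hP
  have hPD := h.le P hP
  constructor
  · intro T hT T' hT' hne W hW W' hW' h1 h2 h3 h4
    rw [mem_tg] at hT hT'
    rw [mem_subs] at hW hW'
    rw [← sup_lines hT.1.2.2 hT'.1.2.2 hne hW.2.2 h1 h2,
      sup_lines hT.1.2.2 hT'.1.2.2 hne hW'.2.2 h3 h4]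
  · intro T hT T' hT' hne
    rw [mem_tg] at hT hT'
    refine ⟨T ⊔ T', ?_, le_sup_left, le_sup_right⟩
    rw [mem_subs]
    refine ⟨hT.1.1.trans le_sup_left, sup_le hT.1.2.1 hT'.1.2.1, ?_⟩
    have h1 := Submodule.finrank_sup_add_finrank_inf_eq T T'
    have h2 : finrank F P ≤ finrank F ↥(T ⊓ T') :=
      Submodule.finrank_mono (le_inf hT.1.1 hT'.1.1)
    rw [hT.1.2.2, hT'.1.2.2] at h1
    by_contra hcon
    have h3 : T = T ⊔ T' := Submodule.eq_of_le_of_finrank_le le_sup_left (by omega)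
    have h4 : T' = T ⊔ T' := Submodule.eq_of_le_of_finrank_le le_sup_right (by omega)
    exact hne (h3.trans h4.symm)
  · intro T hT
    rw [mem_tg] at hT
    rw [← card_cov2 (n := 3) hT.1.2.1 (by rw [hT.1.2.2]) (by rw [hT.1.2.2, h.rk])]
    congr 1
    ext W
    simp only [Finset.mem_filter, mem_subs]
    exact ⟨fun h => ⟨h.2, h.1.2⟩, fun h => ⟨⟨hT.1.1.trans h.1, h.2⟩, h.1⟩⟩
  · exact card_planes hP1 hPD h.rk
  · intro W hW
    rw [mem_subs] at hW
    rw [dd_tg hW.2.1]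
    have h1 := mm_plane h.cap hP hW.1 hW.2.2
    have h2 := mm_pos hP hW.1
    omega
  · intro W hW W' hW' hne hd
    rw [mem_subs] at hW hW'
    rw [dd_tg hW.2.1] at hd
    have h1 := Submodule.finrank_sup_add_finrank_inf_eq W W'
    have h2 : finrank F ↥(W ⊔ W') ≤ finrank F D := Submodule.finrank_mono (sup_le hW.2.1 hW'.2.1)
    have h3 : finrank F ↥(W ⊔ W') = 4 := by
      rw [h.rk] at h2
      by_contra hcon
      have h3 : W = W ⊔ W' := Submodule.eq_of_le_of_finrank_le le_sup_left (by omega)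
      have h4 : W' = W ⊔ W' := Submodule.eq_of_le_of_finrank_le le_sup_right (by omega)
      exact hne (h3.trans h4.symm)
    have h4 : tg C P W = subs P W 2 := by
      apply Finset.eq_of_subset_of_card_le
      · unfold tg; exact Finset.filter_subset _ _
      · rw [hd, card_cov2 hW.1 (by rw [hP1]) (by rw [hP1, hW.2.2])]
    have h5 : W ⊓ W' ∈ tg C P W := by
      rw [h4, mem_subs]
      exact ⟨le_inf hW.1 hW'.1, inf_le_left, by omega⟩
    refine ⟨W ⊓ W', ?_, inf_le_left, inf_le_right⟩
    rw [mem_tg] at h5 ⊢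
    exact ⟨⟨h5.1.1, h5.1.2.1.trans hW.2.1, h5.1.2.2⟩, h5.2⟩

lemma CC.hsq [CharP F 2] (h : CC C D) {P : Submodule F V} (hP : P ∈ C) :
    ∀ T ∈ tg C P D, ∀ s : Finset (Submodule F V), (∀ l, l ∈ s ↔ l ∈ subs P D 3 ∧ T ≤ l) →
      (Fintype.card F : ℤ) ^ 2 + Fintype.card F + 1 - (tg C P D).card ≤
      ∑ l ∈ s, ((dd (fun T W : Submodule F V => T ≤ W) (tg C P D) l : ℤ) - 1) ^ 2 := by
  classical
  intro T hT s hs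
  have hineq := h.tangent_ineq hP hT
  have hu := (h.res hP).sum_u hT
  have hT' := hT
  rw [mem_tg] at hT'
  have hsf : s = (subs P D 3).filter (fun l => T ≤ l) := by
    ext l; rw [hs, Finset.mem_filter]
  have hsc : s = subs T D 3 := by
    ext W
    rw [hs]
    simp only [mem_subs]
    exact ⟨fun h => ⟨h.2, h.1.2⟩, fun h => ⟨⟨hT'.1.1.trans h.1, h.2⟩, h.1⟩⟩
  rw [← hsf] at hu
  rw [← hsc] at hineq
  have hcard : s.card = Fintype.card F + 1 := by
    rw [hsc, card_cov2 hT'.1.2.1 (by rw [hT'.1.2.2]) (by rw [hT'.1.2.2, h.rk])]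
  have e : ∑ α ∈ s, ((mm C α : ℤ) - 1) * ((Fintype.card F : ℤ) + 2 - mm C α) =
      ∑ α ∈ s, ((Fintype.card F : ℤ) + ((Fintype.card F : ℤ) - 1) *
        ((dd (fun T W : Submodule F V => T ≤ W) (tg C P D) α : ℤ) - 1) -
        ((dd (fun T W : Submodule F V => T ≤ W) (tg C P D) α : ℤ) - 1) ^ 2) := by
    apply Finset.sum_congr rfl
    intro α hα
    rw [hs, mem_subs] at hα
    have h1 := mm_plane h.cap hP hα.1.1 hα.1.2.2
    rw [← dd_tg (D := D) hα.1.2.1] at h1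
    have h2 : (mm C α : ℤ) = Fintype.card F + 2 -
        dd (fun T W : Submodule F V => T ≤ W) (tg C P D) α := by
      have := congrArg (Nat.cast : ℕ → ℤ) h1
      push_cast at this
      linarith
    rw [h2]; ring
  rw [e, Finset.sum_sub_distrib, Finset.sum_add_distrib, ← Finset.mul_sum, hu, Finset.sum_const,
    hcard, nsmul_eq_mul] at hineq
  push_cast at hineq
  linarith

lemma CC.types [CharP F 2] (h : CC C D) (hq : 2048 ≤ Fintype.card F)
    (hCc : Fintype.card F ^ 2 + 137 ≤ C.card + 2 * Fintype.card F) {P : Submodule F V} (hP : P ∈ C)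
    (hB : C.card < Fintype.card F ^ 2 + 1 ∨ ∃ W ∈ subs P D 3, mm C W = Fintype.card F) :
    (C.card + Fintype.card F = Fintype.card F ^ 2 + 1 ∧
      ((subs P D 3).filter (fun W => mm C W = Fintype.card F + 1)).card + 1 = Fintype.card F) ∨
    (C.card + Fintype.card F = Fintype.card F ^ 2 + 2 ∧
      (∀ W ∈ subs P D 3, mm C W ≠ Fintype.card F + 1) ∧
      ((subs P D 3).filter (fun W => mm C W = Fintype.card F + 2)).card + 1 = Fintype.card F) ∨
    (C.card + Fintype.card F = Fintype.card F ^ 2 + 2 ∧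
      (∀ W ∈ subs P D 3, mm C W ≠ Fintype.card F + 2) ∧
      ((subs P D 3).filter (fun W => mm C W = Fintype.card F + 1)).card + 1 =
        2 * Fintype.card F) := by
  have hτ := h.tau hP
  have hd : ∀ W ∈ subs P D 3, dd (fun T W : Submodule F V => T ≤ W) (tg C P D) W + mm C W =
      Fintype.card F + 2 := by
    intro W hW
    rw [mem_subs] at hW
    rw [dd_tg hW.2.1]
    exact mm_plane h.cap hP hW.1 hW.2.2
  have key := (h.res hP).types hq (by omega) (by
    rcases hB with hB | ⟨W, hW, hB⟩
    · left; omega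
    · right; exact ⟨W, hW, by have := hd W hW; omega⟩) (h.hsq hP)
  have f1 : (subs P D 3).filter (fun W => dd (fun T W : Submodule F V => T ≤ W) (tg C P D) W = 1) =
      (subs P D 3).filter (fun W => mm C W = Fintype.card F + 1) := by
    apply Finset.filter_congr
    intro W hW
    have := hd W hW
    omega
  have f0 : (subs P D 3).filter (fun W => dd (fun T W : Submodule F V => T ≤ W) (tg C P D) W = 0) =
      (subs P D 3).filter (fun W => mm C W = Fintype.card F + 2) := by
    apply Finset.filter_congr
    intro W hW
    have := hd W hW
    omega
  rw [f1, f0] at key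
  rcases key with ⟨h1, h2⟩ | ⟨h1, h2, h3⟩ | ⟨h1, h2, h3⟩
  · left; exact ⟨by omega, h2⟩
  · right; left
    refine ⟨by omega, fun W hW hc => h2 W hW ?_, h3⟩
    have := hd W hW
    omega
  · right; right
    refine ⟨by omega, fun W hW hc => h2 W hW ?_, h3⟩
    have := hd W hW
    omega

lemma flags (hC : ∀ P ∈ C, finrank F P = 1) (D : Submodule F V) (n c : ℕ)
    (hc : ∀ P ∈ C, ((subs P D 3).filter (fun W => mm C W = n)).card = c) :
    ∃ M, C.card * c = n * M := by
  classical
  refine ⟨((subs ⊥ D 3).filter (fun W => mm C W = n)).card, ?_⟩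
  have hdc : ∑ P ∈ C, (((subs ⊥ D 3).filter (fun W => mm C W = n)).filter (fun W => P ≤ W)).card =
      ∑ W ∈ (subs ⊥ D 3).filter (fun W => mm C W = n), (C.filter (fun P => P ≤ W)).card :=
    Finset.sum_card_bipartiteAbove_eq_sum_card_bipartiteBelow (fun P W => P ≤ W)
  have h1 : ∀ P ∈ C,
      (((subs ⊥ D 3).filter (fun W => mm C W = n)).filter (fun W => P ≤ W)).card = c := by
    intro P hP
    rw [← hc P hP]
    congr 1
    ext W
    simp only [Finset.mem_filter, mem_subs]
    constructor
    · rintro ⟨⟨⟨_, h2⟩, h3⟩, h4⟩; exact ⟨⟨h4, h2⟩, h3⟩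
    · rintro ⟨⟨h4, h2⟩, h3⟩; exact ⟨⟨⟨bot_le, h2⟩, h3⟩, h4⟩
  have h2 : ∀ W ∈ (subs ⊥ D 3).filter (fun W => mm C W = n),
      (C.filter (fun P => P ≤ W)).card = n := by
    intro W hW
    rw [Finset.mem_filter] at hW
    rw [← hW.2]; unfold mm; congr
  rw [Finset.sum_congr rfl h1, Finset.sum_congr rfl h2, Finset.sum_const, Finset.sum_const,
    smul_eq_mul, smul_eq_mul] at hdc
  rw [hdc, mul_comm]

lemma not_dvd_small {a b : ℤ} (hb : 0 < b) (h : b < a) : ¬ a ∣ b := fun hd =>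
  absurd (Int.le_of_dvd hb hd) (by omega)

lemma CC.contra [CharP F 2] (h : CC C D) (hq : 2048 ≤ Fintype.card F)
    (hCc : Fintype.card F ^ 2 + 137 ≤ C.card + 2 * Fintype.card F)
    {W : Submodule F V} (hWD : W ≤ D) (hW : finrank F W = 3) (hm : mm C W = Fintype.card F) :
    False := by
  classical
  have hqz : (2048 : ℤ) ≤ Fintype.card F := by exact_mod_cast hq
  obtain ⟨P, hP, hPW⟩ : ∃ P ∈ C, P ≤ W := by
    have : 0 < mm C W := by omega
    unfold mm at this
    obtain ⟨P, hP⟩ := Finset.card_pos.mp this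
    rw [Finset.mem_filter] at hP
    exact ⟨P, hP⟩
  have h0 := h.types hq hCc hP (Or.inr ⟨W, mem_subs.mpr ⟨hPW, hWD, hW⟩, hm⟩)
  have hlt : C.card < Fintype.card F ^ 2 + 1 := by
    rcases h0 with h0 | h0 | h0 <;> omega
  have hall := fun Q (hQ : Q ∈ C) => h.types hq hCc hQ (Or.inl hlt)
  have h01 : C.card + Fintype.card F = Fintype.card F ^ 2 + 1 ∨
      C.card + Fintype.card F = Fintype.card F ^ 2 + 2 := by
    rcases h0 with h0 | h0 | h0 <;> omega
  rcases h01 with hc | hc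
  · obtain ⟨M, hM⟩ := flags h.cap.1 D (Fintype.card F + 1) (Fintype.card F - 1) (by
      intro Q hQ
      rcases hall Q hQ with h1 | h1 | h1 <;> omega)
    generalize Fintype.card F = q at *
    zify [show 1 ≤ q by omega] at hM hc
    apply not_dvd_small (a := (q : ℤ) + 1) (b := 6) (by norm_num) (by omega)
    have : (C.card : ℤ) = q ^ 2 + 1 - q := by linarith
    rw [this] at hM
    exact ⟨(q : ℤ) ^ 2 - 3 * q + 5 - M, by linear_combination -hM⟩
  · have hall2 := fun Q (hQ : Q ∈ C) => (hall Q hQ).resolve_left (by omega)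
    by_cases hC3 : ∀ Q ∈ C, (∀ W ∈ subs Q D 3, mm C W ≠ Fintype.card F + 2) ∧
      ((subs Q D 3).filter (fun W => mm C W = Fintype.card F + 1)).card + 1 = 2 * Fintype.card F
    · obtain ⟨M, hM⟩ := flags h.cap.1 D (Fintype.card F + 1) (2 * Fintype.card F - 1) (by
        intro Q hQ
        have := (hC3 Q hQ).2
        omega)
      generalize Fintype.card F = q at *
      zify [show 1 ≤ 2 * q by omega] at hM hc
      apply not_dvd_small (a := (q : ℤ) + 1) (b := 12) (by norm_num) (by omega)
      have : (C.card : ℤ) = q ^ 2 + 2 - q := by linarith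
      rw [this] at hM
      exact ⟨2 * (q : ℤ) ^ 2 - 5 * q + 10 - M, by linear_combination -hM⟩
    · push Not at hC3
      obtain ⟨Q0, hQ0, hQ0n⟩ := hC3
      have hQB := (hall2 Q0 hQ0).resolve_right (fun hh => hQ0n hh.2.1 hh.2.2)
      obtain ⟨M, hM⟩ := flags h.cap.1 D (Fintype.card F + 2) (Fintype.card F - 1) (by
        intro Q hQ
        rcases hall2 Q hQ with h1 | h1
        · omega
        · exfalso
          have hne : Q0 ≠ Q := by
            rintro rfl
            exact hQ0n h1.2.1 h1.2.2
          have hL := finrank_line (h.cap.1 Q0 hQ0) (h.cap.1 Q hQ) hne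
          have hLD : Q0 ⊔ Q ≤ D := sup_le (h.le _ hQ0) (h.le _ hQ)
          have h2 := sum_cov (n := 3) (by omega) hLD C h.cap.1 h.le
          have h3 : ∑ W ∈ subs (Q0 ⊔ Q) D 3, mm C W ≤
              (subs (Q0 ⊔ Q) D 3).card • Fintype.card F := by
            apply Finset.sum_le_card_nsmul
            intro W hW
            rw [mem_subs] at hW
            have e1 := hQB.2.1 W (mem_subs.mpr ⟨le_sup_left.trans hW.1, hW.2⟩)
            have e2 := h1.2.1 W (mem_subs.mpr ⟨le_sup_right.trans hW.1, hW.2⟩)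
            have e3 := mm_plane h.cap hQ0 (le_sup_left.trans hW.1) hW.2.2
            omega
          rw [mm_secant h.cap hQ0 hQ hne] at h2
          rw [card_cov2 hLD (by rw [hL]) (by rw [hL, h.rk])] at h2 h3
          rw [smul_eq_mul] at h3
          nlinarith)
      generalize Fintype.card F = q at *
      zify [show 1 ≤ q by omega] at hM hc
      apply not_dvd_small (a := (q : ℤ) + 2) (b := 24) (by norm_num) (by omega)
      have : (C.card : ℤ) = q ^ 2 + 2 - q := by linarith
      rw [this] at hM
      exact ⟨(q : ℤ) ^ 2 - 4 * q + 11 - M, by linear_combination -hM⟩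

end capthree2


set_option linter.unusedSectionVars false

section final
open Module

variable {F : Type*} [Field F] [Fintype F] {V : Type*} [AddCommGroup V] [Module F V]
  [FiniteDimensional F V] [Finite V]

/-- if `S` lies on the line `Z ⊔ Q` then `Z` lies on `Q ⊔ S` -/
lemma swap_line {Z Q S : Submodule F V} (hZ : finrank F Z = 1) (hQ : finrank F Q = 1)
    (hS : finrank F S = 1) (hSQ : S ≠ Q) (h : S ≤ Z ⊔ Q) : Z ≤ Q ⊔ S := by
  rw [exchange hS hZ (fun hc => hSQ (pt_le_eq hS hQ hc)) (by rwa [sup_comm])]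
  exact le_sup_right

open Classical in
lemma cap_insert {C : Finset (Submodule F V)} (hC : Cap C) {Z : Submodule F V}
    (hZ : finrank F Z = 1) (h : ∀ R ∈ C, ∀ R' ∈ C, R ≠ R' → ¬ Z ≤ R ⊔ R') :
    Cap (insert Z C) := by
  refine ⟨fun P hP => ?_, fun P hP Q hQ S hS h1 h2 h3 hle => ?_⟩
  · rcases Finset.mem_insert.mp hP with rfl | hP
    · exact hZ
    · exact hC.1 P hP
  rcases Finset.mem_insert.mp hP with rfl | hP'
  · have hQ := Finset.mem_of_mem_insert_of_ne hQ h1.symm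
    have hS := Finset.mem_of_mem_insert_of_ne hS h2.symm
    exact h Q hQ S hS h3 (swap_line hZ (hC.1 Q hQ) (hC.1 S hS) h3.symm hle)
  rcases Finset.mem_insert.mp hQ with rfl | hQ'
  · have hS := Finset.mem_of_mem_insert_of_ne hS h3.symm
    exact h P hP' S hS h2 (swap_line hZ (hC.1 P hP') (hC.1 S hS) h2.symm (by rwa [sup_comm]))
  rcases Finset.mem_insert.mp hS with rfl | hS'
  · exact h P hP' Q hQ' h1 hle
  · exact hC.2 P hP' Q hQ' S hS' h1 h2 h3 hle

lemma exists_CC {C : Finset (Submodule F V)} {D : Submodule F V} (hC : Cap C)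
    (hCD : ∀ P ∈ C, P ≤ D) (hD : finrank F D = 4) : ∃ C', C ⊆ C' ∧ CC C' D := by
  classical
  obtain ⟨C', hCC, hmax⟩ := (Set.toFinite
    {C' : Finset (Submodule F V) | Cap C' ∧ ∀ P ∈ C', P ≤ D}).exists_le_maximal
    (a := C) ⟨hC, hCD⟩
  refine ⟨C', hCC, hmax.prop.1, hmax.prop.2, hD, fun Z hZ hZD hZC => ?_⟩
  by_contra hcon
  push Not at hcon
  have h1 := hmax.le_of_ge (y := insert Z C') ⟨cap_insert hmax.prop.1 hZ hcon, fun P hP => by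
    rcases Finset.mem_insert.mp hP with rfl | hP
    · exact hZD
    · exact hmax.prop.2 P hP⟩ (Finset.subset_insert _ _)
  exact hZC (h1 (Finset.mem_insert_self _ _))

/-- `Z` is a point of `π` off `K` on no secant of `K` inside `D` -/
def FreePt (K : Finset (Submodule F V)) (π D Z : Submodule F V) : Prop :=
  finrank F Z = 1 ∧ Z ≤ π ∧ Z ∉ K ∧
    ∀ R ∈ K, ∀ R' ∈ K, R ≤ D → R' ≤ D → R ≠ R' → ¬ Z ≤ R ⊔ R'

lemma exists_free [CharP F 2] {K : Finset (Submodule F V)} (hK : Cap K) {π D : Submodule F V}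
    (hq : 2048 ≤ Fintype.card F) (hπ : finrank F π = 3) (hD : finrank F D = 4) (hπD : π ≤ D)
    (hm : mm K π = Fintype.card F)
    (hc : Fintype.card F ^ 2 + 137 ≤ mm K D + 2 * Fintype.card F) :
    ∃ Z, FreePt K π D Z := by
  classical
  obtain ⟨C', hCC, h⟩ := exists_CC (C := K.filter (fun P => P ≤ D)) (D := D)
    ⟨fun P hP => hK.1 P (Finset.mem_filter.mp hP).1, fun P hP Q hQ S hS =>
      hK.2 P (Finset.mem_filter.mp hP).1 Q (Finset.mem_filter.mp hQ).1
        S (Finset.mem_filter.mp hS).1⟩ (fun P hP => (Finset.mem_filter.mp hP).2) hD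
  by_contra hcon
  push Not at hcon
  have hcard := Finset.card_le_card hCC
  have hmm : mm K D = (K.filter (fun P => P ≤ D)).card := by unfold mm; congr
  refine h.contra hq (by omega) hπD hπ ?_
  rw [← hm]
  unfold mm
  congr 1
  ext Z
  simp only [Finset.mem_filter]
  refine ⟨fun hZ => ⟨?_, hZ.2⟩, fun hZ => ⟨hCC (Finset.mem_filter.mpr ⟨hZ.1, hZ.2.trans hπD⟩),
    hZ.2⟩⟩
  by_contra hZK
  refine hcon Z ⟨h.cap.1 Z hZ.1, hZ.2, hZK, fun R hR R' hR' h1 h2 hne hle => ?_⟩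
  have hR1 := hCC (Finset.mem_filter.mpr ⟨hR, h1⟩)
  have hR2 := hCC (Finset.mem_filter.mpr ⟨hR', h2⟩)
  exact h.cap.2 R hR1 R' hR2 Z hZ.1 hne (fun e => hZK (e ▸ hR)) (fun e => hZK (e ▸ hR')) hle

lemma free_three {K : Finset (Submodule F V)} (hK : Cap K) {π : Submodule F V}
    (hq : 4 ≤ Fintype.card F) (hπ : finrank F π = 3) (hm : mm K π = Fintype.card F)
    {X Y Z : Submodule F V} (hX : FreePt K π π X) (hY : FreePt K π π Y) (hZ : FreePt K π π Z)
    (hXY : X ≠ Y) (hXZ : X ≠ Z) (hYZ : Y ≠ Z) : False := by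
  classical
  -- joining a free point to a point of the arc gives a tangent
  have htan : ∀ X, FreePt K π π X → ∀ P ∈ K, P ≤ π → X ⊔ P ∈ tg K P π := by
    intro X hX P hP hPπ
    have hne : X ≠ P := fun e => hX.2.2.1 (e ▸ hP)
    rw [mem_tg]
    refine ⟨⟨le_sup_right, sup_le hX.2.1 hPπ, finrank_line hX.1 (hK.1 P hP) hne⟩, ?_⟩
    rw [mm_one hP le_sup_right]
    intro S hS hle
    by_contra hSP
    exact hX.2.2.2 P hP S hS hPπ (hle.trans (sup_le hX.2.1 hPπ)) (Ne.symm hSP)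
      (swap_line hX.1 (hK.1 P hP) (hK.1 S hS) hSP hle)
  have hline : ∀ X Y, FreePt K π π X → FreePt K π π Y → X ≠ Y →
      (K.filter (fun P => P ≤ X ⊔ Y)).card ≤ 1 := by
    intro X Y hX hY hXY
    rw [Finset.card_le_one]
    intro P hP Q hQ
    rw [Finset.mem_filter] at hP hQ
    by_contra hPQ
    have h2 : finrank F ↥(P ⊔ Q) = 2 := finrank_line (hK.1 P hP.1) (hK.1 Q hQ.1) hPQ
    have h3 : P ⊔ Q = X ⊔ Y := Submodule.eq_of_le_of_finrank_le (sup_le hP.2 hQ.2)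
      (by rw [h2, finrank_line hX.1 hY.1 hXY])
    have h4 : X ⊔ Y ≤ π := sup_le hX.2.1 hY.2.1
    exact hX.2.2.2 P hP.1 Q hQ.1 (hP.2.trans h4) (hQ.2.trans h4) hPQ (h3 ▸ le_sup_left)
  have heq : ∀ X Y P : Submodule F V, FreePt K π π X → FreePt K π π Y → X ≠ Y → finrank F P = 1 →
      P ∈ K → X ⊔ P = Y ⊔ P → P ≤ X ⊔ Y := by
    intro X Y P hX hY hXY hP hPK he
    have hne : X ≠ P := fun e => hX.2.2.1 (e ▸ hPK)
    have h3 : X ⊔ Y = X ⊔ P := Submodule.eq_of_le_of_finrank_le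
      (sup_le le_sup_left (he ▸ le_sup_left))
      (by rw [finrank_line hX.1 hY.1 hXY, finrank_line hX.1 hP hne])
    rw [h3]; exact le_sup_right
  have hsub : K.filter (fun P => P ≤ π) ⊆ (K.filter (fun P => P ≤ X ⊔ Y) ∪
      K.filter (fun P => P ≤ X ⊔ Z)) ∪ K.filter (fun P => P ≤ Y ⊔ Z) := by
    intro P hP
    rw [Finset.mem_filter] at hP
    have h1 := mm_plane hK hP.1 hP.2 hπ
    have h2 : (tg K P π).card = 2 := by omega
    by_contra hcon
    simp only [Finset.mem_union, Finset.mem_filter, hP.1, true_and, not_or] at hcon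
    have h3 : 2 < (tg K P π).card := by
      rw [Finset.two_lt_card]
      exact ⟨X ⊔ P, htan X hX P hP.1 hP.2, Y ⊔ P, htan Y hY P hP.1 hP.2, Z ⊔ P,
        htan Z hZ P hP.1 hP.2,
        fun e => hcon.1.1 (heq X Y P hX hY hXY (hK.1 P hP.1) hP.1 e),
        fun e => hcon.1.2 (heq X Z P hX hZ hXZ (hK.1 P hP.1) hP.1 e),
        fun e => hcon.2 (heq Y Z P hY hZ hYZ (hK.1 P hP.1) hP.1 e)⟩
    omega
  have hc := Finset.card_le_card hsub
  have hu1 := Finset.card_union_le (K.filter (fun P => P ≤ X ⊔ Y) ∪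
      K.filter (fun P => P ≤ X ⊔ Z)) (K.filter (fun P => P ≤ Y ⊔ Z))
  have hu2 := Finset.card_union_le (K.filter (fun P => P ≤ X ⊔ Y))
      (K.filter (fun P => P ≤ X ⊔ Z))
  have h1 := hline X Y hX hY hXY
  have h2 := hline X Z hX hZ hXZ
  have h3 := hline Y Z hY hZ hYZ
  have hmm : mm K π = (K.filter (fun P => P ≤ π)).card := by unfold mm; congr
  omega

lemma inf_eq_plane {π D E : Submodule F V} (hπ : finrank F π = 3) (hD : finrank F D = 4)
    (hE : finrank F E = 4) (h1 : π ≤ D) (h2 : π ≤ E) (hne : D ≠ E) : D ⊓ E = π := by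
  symm
  apply Submodule.eq_of_le_of_finrank_le (le_inf h1 h2)
  by_contra hcon
  push Not at hcon
  have h3 : D ⊓ E = D := Submodule.eq_of_le_of_finrank_le inf_le_left (by omega)
  have h4 : D ⊓ E = E := Submodule.eq_of_le_of_finrank_le inf_le_right (by omega)
  exact hne (h3.symm.trans h4)

/-- the main counting statement in terms of finite sets of submodules -/
lemma main_count [CharP F 2] {K : Finset (Submodule F V)} (hV : finrank F V = 5) (hK : Cap K)
    (hcomp : ∀ Z : Submodule F V, finrank F Z = 1 → Z ∉ K →
      ∃ R ∈ K, ∃ R' ∈ K, R ≠ R' ∧ Z ≤ R ⊔ R')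
    (hq : 2048 ≤ Fintype.card F) {π : Submodule F V} (hπ : finrank F π = 3)
    (hm : mm K π = Fintype.card F) (δ : Fin 5 → Submodule F V) (hδ : Function.Injective δ)
    (hδrk : ∀ i, finrank F (δ i) = 4) (hδπ : ∀ i, π ≤ δ i)
    (hc : ∀ i, Fintype.card F ^ 2 + 137 ≤ mm K (δ i) + 2 * Fintype.card F) :
    ∃ a b c, mm K (δ a) + mm K (δ b) + mm K (δ c) + K.card +
      2 * (Fintype.card F ^ 2 + Fintype.card F + 1) ≤
      (Fintype.card F ^ 2 + Fintype.card F + 1) * (Fintype.card F + 2) + 2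
        + 2 * Fintype.card F := by
  classical
  choose N hN using fun i => exists_free hK hq hπ (hδrk i) (hδπ i) hm (hc i)
  have hN' : ∀ i, FreePt K π π (N i) := fun i => ⟨(hN i).1, (hN i).2.1, (hN i).2.2.1,
    fun R hR R' hR' h1 h2 => (hN i).2.2.2 R hR R' hR' (h1.trans (hδπ i)) (h2.trans (hδπ i))⟩
  have him : (Finset.univ.image N).card ≤ 2 := by
    by_contra hcon
    push Not at hcon
    rw [Finset.two_lt_card] at hcon
    obtain ⟨x, hx, y, hy, z, hz, h1, h2, h3⟩ := hcon
    simp only [Finset.mem_image, Finset.mem_univ, true_and] at hx hy hz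
    obtain ⟨i, rfl⟩ := hx
    obtain ⟨j, rfl⟩ := hy
    obtain ⟨k, rfl⟩ := hz
    exact free_three hK (by omega) hπ hm (hN' i) (hN' j) (hN' k) h1 h2 h3
  obtain ⟨Z, -, hZ⟩ := Finset.exists_lt_card_fiber_of_mul_lt_card_of_maps_to
    (s := Finset.univ) (t := Finset.univ.image N) (f := N) (n := 2)
    (fun i _ => Finset.mem_image_of_mem N (Finset.mem_univ i))
    (by rw [Finset.card_univ, Fintype.card_fin]; omega)
  rw [Finset.two_lt_card] at hZ
  obtain ⟨a, ha, b, hb, c, hcc, hab, hac, hbc⟩ := hZ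
  simp only [Finset.mem_filter, Finset.mem_univ, true_and] at ha hb hcc
  refine ⟨a, b, c, ?_⟩
  have hZa : FreePt K π (δ a) Z := ha ▸ hN a
  have hZb : FreePt K π (δ b) Z := hb ▸ hN b
  have hZc : FreePt K π (δ c) Z := hcc ▸ hN c
  obtain ⟨R, hR, R', hR', hRR, hZR⟩ := hcomp Z hZa.1 hZa.2.2.1
  have hmm : ∀ W, mm K W = (K.filter (fun P => P ≤ W)).card := by intro W; unfold mm; congr
  have hgood : ∀ i, FreePt K π (δ i) Z → ∀ P ∈ K.filter (fun P => P ≤ δ i), ∀ S ∈ K, S ≠ P →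
      ¬ S ≤ Z ⊔ P := by
    intro i hZ P hP S hS hSP hle
    rw [Finset.mem_filter] at hP
    exact hZ.2.2.2 P hP.1 S hS hP.2 (hle.trans (sup_le (hZ.2.1.trans (hδπ i)) hP.2))
      (Ne.symm hSP) (swap_line hZ.1 (hK.1 P hP.1) (hK.1 S hS) hSP hle)
  have hseg := segre_sum (D := ⊤) (C := K) (U := (K.filter (fun P => P ≤ δ a) ∪
    K.filter (fun P => P ≤ δ b)) ∪ K.filter (fun P => P ≤ δ c)) hK (fun _ _ => le_top) hR hR'
    hRR hZa.1 hZR hZa.2.2.1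
    (Finset.union_subset (Finset.union_subset (Finset.filter_subset _ _)
      (Finset.filter_subset _ _)) (Finset.filter_subset _ _))
    (fun P hP => by
      rcases Finset.mem_union.mp hP with hP | hP
      · rcases Finset.mem_union.mp hP with hP | hP
        · exact hgood a hZa P hP
        · exact hgood b hZb P hP
      · exact hgood c hZc P hP)
  have hL := finrank_line (hK.1 R hR) (hK.1 R' hR') hRR
  rw [card_cov3 (n := 3) le_top (by rw [hL]) (by rw [hL, finrank_top, hV])] at hseg
  have hinf : ∀ i j, i ≠ j → ∀ P : Submodule F V, P ≤ δ i → P ≤ δ j → P ≤ π := by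
    intro i j hij P h1 h2
    rw [← inf_eq_plane hπ (hδrk i) (hδrk j) (hδπ i) (hδπ j) (fun e => hij (hδ e))]
    exact le_inf h1 h2
  have hi1 : (K.filter (fun P => P ≤ δ a) ∩ K.filter (fun P => P ≤ δ b)).card ≤
      Fintype.card F := by
    rw [← hm, hmm]
    apply Finset.card_le_card
    intro P hP
    simp only [Finset.mem_inter, Finset.mem_filter] at hP ⊢
    exact ⟨hP.1.1, hinf a b hab P hP.1.2 hP.2.2⟩
  have hi2 : ((K.filter (fun P => P ≤ δ a) ∪ K.filter (fun P => P ≤ δ b)) ∩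
      K.filter (fun P => P ≤ δ c)).card ≤ Fintype.card F := by
    rw [← hm, hmm]
    apply Finset.card_le_card
    intro P hP
    simp only [Finset.mem_inter, Finset.mem_union, Finset.mem_filter] at hP ⊢
    refine ⟨hP.2.1, ?_⟩
    rcases hP.1 with h | h
    · exact hinf a c hac P h.2 hP.2.2
    · exact hinf b c hbc P h.2 hP.2.2
  have hu1 := Finset.card_union_add_card_inter (K.filter (fun P => P ≤ δ a))
    (K.filter (fun P => P ≤ δ b))
  have hu2 := Finset.card_union_add_card_inter (K.filter (fun P => P ≤ δ a) ∪
    K.filter (fun P => P ≤ δ b)) (K.filter (fun P => P ≤ δ c))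
  rw [hmm (δ a), hmm (δ b), hmm (δ c)]
  omega

end final

theorem stmt19 (F : Type*) [Field F] [Fintype F] (q : ℕ) (hcard : Fintype.card F = q)
    (hqeven : Even q) (hq : 2048 ≤ q)
    (K : Set (PGPoint F 4)) (hK : IsCompleteCap K)
    (hk : (q : ℝ) ^ 3 - 2 * (q : ℝ) ^ 2 + 3 * (q : ℝ) * Real.sqrt q + 8 * (q : ℝ) - 9 * Real.sqrt q - 6 ≤ (K.ncard : ℝ))
    (π : Submodule F (Fin 5 → F)) (hπ : Module.finrank F π = 3)
    (hπK : (ptsIn π ∩ K).ncard = q)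
    (δ : Fin 5 → Submodule F (Fin 5 → F)) (hδinj : Function.Injective δ)
    (hδrk : ∀ i, Module.finrank F (δ i) = 4) (hδπ : ∀ i, π ≤ δ i)
    (hδK : ∀ i, (q : ℝ) ^ 2 - 2 * (q : ℝ) + 3 * Real.sqrt q + 2
      ≤ ((ptsIn (δ i) ∩ K).ncard : ℝ)) :
    False := by
  classical
  subst hcard
  have : Finite (PGPoint F 4) := by
    have : Function.Injective (Projectivization.submodule : PGPoint F 4 → Submodule F (Fin 5 → F)) :=
      Projectivization.submodule_injective
    exact Finite.of_injective _ this
  have : CharP F 2 := by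
    have h := FiniteField.even_card_iff_char_two (F := F)
    have h2 : ringChar F = 2 := h.mpr (Nat.even_iff.mp hqeven)
    rw [← h2]; exact ringChar.charP F
  have hfin : K.Finite := Set.toFinite K
  set K' : Finset (Submodule F (Fin 5 → F)) := hfin.toFinset.image Projectivization.submodule
    with hK'
  have hmem : ∀ P : PGPoint F 4, P.submodule ∈ K' ↔ P ∈ K := by
    intro P
    rw [hK', Finset.mem_image]
    constructor
    · rintro ⟨Q, hQ, he⟩
      rw [← Projectivization.submodule_injective he]
      exact hfin.mem_toFinset.mp hQ
    · intro h
      exact ⟨P, hfin.mem_toFinset.mpr h, rfl⟩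
  have hlift : ∀ Z : Submodule F (Fin 5 → F), finrank F Z = 1 →
      ∃ P : PGPoint F 4, P.submodule = Z := by
    intro Z hZ
    exact ⟨Projectivization.mk'' Z hZ, Projectivization.submodule_mk'' Z hZ⟩
  have hrk : ∀ P : PGPoint F 4, finrank F P.submodule = 1 := fun P => P.finrank_submodule
  have hcoll : ∀ P Q S : PGPoint F 4, P ≠ Q →
      (Coll3 P Q S ↔ S.submodule ≤ P.submodule ⊔ Q.submodule) := by
    intro P Q S hPQ
    have h2 := finrank_line (hrk P) (hrk Q) (fun e => hPQ (Projectivization.submodule_injective e))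
    unfold Coll3
    constructor
    · intro h
      by_contra hcon
      have := finrank_sup_pt (hrk S) hcon
      omega
    · intro h
      rw [sup_eq_left.mpr h, h2]
  have hlift' : ∀ Z ∈ K', ∃ P ∈ K, P.submodule = Z := by
    intro Z hZ
    rw [hK', Finset.mem_image] at hZ
    obtain ⟨P, hP, he⟩ := hZ
    exact ⟨P, hfin.mem_toFinset.mp hP, he⟩
  have hcap : Cap K' := by
    refine ⟨fun Z hZ => ?_, fun P hP Q hQ S hS h1 h2 h3 hle => ?_⟩
    · obtain ⟨P, -, rfl⟩ := hlift' Z hZ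
      exact hrk P
    · obtain ⟨P, hPK, rfl⟩ := hlift' P hP
      obtain ⟨Q, hQK, rfl⟩ := hlift' Q hQ
      obtain ⟨S, hSK, rfl⟩ := hlift' S hS
      have h1' : P ≠ Q := fun e => h1 (e ▸ rfl)
      exact hK.1 P hPK Q hQK S hSK h1' (fun e => h2 (e ▸ rfl)) (fun e => h3 (e ▸ rfl))
        ((hcoll P Q S h1').mpr hle)
  have hcomp : ∀ Z : Submodule F (Fin 5 → F), finrank F Z = 1 → Z ∉ K' →
      ∃ R ∈ K', ∃ R' ∈ K', R ≠ R' ∧ Z ≤ R ⊔ R' := by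
    intro Z hZ hZK
    by_contra hcon
    push Not at hcon
    obtain ⟨N, rfl⟩ := hlift Z hZ
    have hNK : N ∉ K := fun h => hZK ((hmem N).mpr h)
    have hins := cap_insert hcap hZ hcon
    apply hK.2 N hNK
    have hmem' : ∀ P ∈ insert N K, P.submodule ∈ insert N.submodule K' := by
      intro P hP
      rcases hP with rfl | hP
      · exact Finset.mem_insert_self _ _
      · exact Finset.mem_insert_of_mem ((hmem P).mpr hP)
    intro P hP Q hQ S hS h1 h2 h3 h
    exact hins.2 _ (hmem' P hP) _ (hmem' Q hQ) _ (hmem' S hS)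
      (fun e => h1 (Projectivization.submodule_injective e))
      (fun e => h2 (Projectivization.submodule_injective e))
      (fun e => h3 (Projectivization.submodule_injective e)) ((hcoll P Q S h1).mp h)
  have hmm : ∀ W : Submodule F (Fin 5 → F), (ptsIn W ∩ K).ncard = mm K' W := by
    intro W
    unfold mm
    rw [← Set.ncard_image_of_injective (ptsIn W ∩ K) Projectivization.submodule_injective,
      ← Set.ncard_coe_finset]
    congr 1
    ext Z
    simp only [Set.mem_image, Finset.coe_filter, Set.mem_ofPred_eq]
    constructor
    · rintro ⟨P, ⟨hPW, hPK⟩, rfl⟩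
      exact ⟨(hmem P).mpr hPK, hPW⟩
    · rintro ⟨hZ, hZW⟩
      obtain ⟨P, hP, rfl⟩ := hlift' Z hZ
      exact ⟨P, ⟨hZW, hP⟩, rfl⟩
  have hKc : K.ncard = K'.card := by
    rw [hK', Finset.card_image_of_injective _ Projectivization.submodule_injective,
      Set.ncard_eq_toFinset_card K hfin]
  set q := Fintype.card F with hqdef
  have hs0 : 0 ≤ Real.sqrt q := Real.sqrt_nonneg _
  have hq' : (2048 : ℝ) ≤ q := by exact_mod_cast hq
  have hs : (45 : ℝ) ≤ Real.sqrt q := Real.le_sqrt_of_sq_le (by linarith)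
  simp only [hmm] at hδK hπK
  rw [hKc] at hk
  have hc : ∀ i, q ^ 2 + 137 ≤ mm K' (δ i) + 2 * q := by
    intro i
    have h1 := hδK i
    have h2 : ((q ^ 2 + 137 : ℕ) : ℝ) ≤ ((mm K' (δ i) + 2 * q : ℕ) : ℝ) := by
      push_cast; linarith
    exact_mod_cast h2
  obtain ⟨a, b, c, hfinal⟩ := main_count (by simp) hcap hcomp hq hπ hπK δ hδinj hδrk hδπ hc
  have hf : (mm K' (δ a) : ℝ) + mm K' (δ b) + mm K' (δ c) + K'.card + 2 * ((q : ℝ) ^ 2 + q + 1) ≤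
      ((q : ℝ) ^ 2 + q + 1) * (q + 2) + 2 + 2 * q := by exact_mod_cast hfinal
  have ha := hδK a
  have hb := hδK b
  have hc' := hδK c
  have hqs : (q : ℝ) * 45 ≤ q * Real.sqrt q := by gcongr
  nlinarith
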